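/- Fix an integer n ≥ 2 and a splitting type r, and set C_{k,r} = (δ(r)−δ(r)²)^{k/2}·k!/(2^{k/2}(k/2)!) for even k. Let x = N^{1/log log N}. There exist constants c, C > 0 depending only on n and r such that for all sufficiently large N and all even natural numbers k with k ≤ c·log log N, one has | 𝔼_N( (π_{f,r}(x) − δ(r)π(x))^k ) − C_{k,r}·π(x)^{k/2} | ≤ C·C_{k,r}·π(x)^{k/2}·(1/(1−δ(r))^{k/2})·(log log x)/π(x)^{1/2}. -/

import Mathlib

/-!
Arithmetic statistics of families of integer `S_n`-polynomials (I. Viglino).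

`𝒫_{n,N}` is the family of monic integer polynomials
`f(X) = X^n + a_{n-1}X^{n-1} + ⋯ + a_0` with `|a_i| ≤ N`, identified with their
coefficient vectors `a : Fin n → ℤ`, and `𝒫⁰_{n,N} ⊆ 𝒫_{n,N}` is the subfamily of
`f` whose splitting field over `ℚ` has Galois group isomorphic to `S_n`.
-/

open Polynomial Finset Filter

attribute [local instance] Classical.propDecidable

noncomputable section

/-- The monic integer polynomial `X^n + a_{n-1}X^{n-1} + ⋯ + a_0`. -/
def intPoly (n : ℕ) (a : Fin n → ℤ) : Polynomial ℤ :=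
  Polynomial.X ^ n + ∑ i : Fin n, Polynomial.C (a i) * Polynomial.X ^ (i : ℕ)

/-- The same polynomial viewed over `ℚ`. -/
def ratPoly (n : ℕ) (a : Fin n → ℤ) : Polynomial ℚ :=
  (intPoly n a).map (Int.castRingHom ℚ)

/-- Coefficient vectors with entries in `{-N, …, N}`: the family `𝒫_{n,N}`. -/
def coeffBox (n N : ℕ) : Finset (Fin n → ℤ) :=
  Fintype.piFinset fun _ => Finset.Icc (-(N : ℤ)) (N : ℤ)

/-- `f` is an `S_n`-polynomial: the Galois group of its splitting field `K_f` over `ℚ`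
is isomorphic to the symmetric group on `n` letters. -/
def IsSnPoly (n : ℕ) (a : Fin n → ℤ) : Prop :=
  Nonempty ((ratPoly n a).Gal ≃* Equiv.Perm (Fin n))

/-- The family `𝒫⁰_{n,N}` of `S_n`-polynomials, as a finset of coefficient vectors. -/
def P0 (n N : ℕ) : Finset (Fin n → ℤ) :=
  (coeffBox n N).filter fun a => IsSnPoly n a

/-- `ℙ_N`, the uniform probability of an event in `𝒫⁰_{n,N}`. -/
def probN (n N : ℕ) (E : (Fin n → ℤ) → Prop) : ℝ :=
  (((P0 n N).filter E).card : ℝ) / ((P0 n N).card : ℝ)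

/-- `𝔼_N`, the expectation of a real random variable on `𝒫⁰_{n,N}`. -/
def expN (n N : ℕ) (F : (Fin n → ℤ) → ℝ) : ℝ :=
  (∑ a ∈ P0 n N, F a) / ((P0 n N).card : ℝ)

/-- `π(x)`, the number of rational primes `≤ x`. -/
def primePi (x : ℝ) : ℕ :=
  ((Finset.range (⌊x⌋₊ + 1)).filter Nat.Prime).card

/-- `g ∈ 𝔽_p[X]` has splitting type `r = (r_1, …, r_n)` — encoded by `r : Fin n → ℕ` where
`r i` is `r_{i+1}`, the number of factors of degree `i+1` —, i.e. `g` is a product of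
distinct monic irreducible polynomials with exactly `r i` monic irreducible factors of
degree `i+1` for each `i`. -/
def SplitTypeOf {p : ℕ} (g : Polynomial (ZMod p)) {n : ℕ} (r : Fin n → ℕ) : Prop :=
  Squarefree g ∧ ∀ i : Fin n,
    Nat.card {h : Polynomial (ZMod p) // h.Monic ∧ Irreducible h ∧
      h.natDegree = (i : ℕ) + 1 ∧ h ∣ g} = r i

/-- `f` has splitting type `r` modulo `p`. -/
def HasSplitType (n : ℕ) (r : Fin n → ℕ) (a : Fin n → ℤ) (p : ℕ) : Prop :=
  SplitTypeOf ((intPoly n a).map (Int.castRingHom (ZMod p))) r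

/-- `π_{f,r}(x)`: the number of primes `p ≤ x` such that `f` has splitting type `r` mod `p`. -/
def countSplit (n : ℕ) (r : Fin n → ℕ) (a : Fin n → ℤ) (x : ℝ) : ℕ :=
  ((Finset.range (⌊x⌋₊ + 1)).filter fun p => p.Prime ∧ HasSplitType n r a p).card

/-- `δ(r) = ∏_{i=1}^n 1/(i^{r_i}·r_i!)`. -/
def splitDelta (n : ℕ) (r : Fin n → ℕ) : ℝ :=
  ∏ i : Fin n, (1 : ℝ) / ((((i : ℕ) + 1) ^ (r i) * Nat.factorial (r i) : ℕ) : ℝ)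

/-- `r_i` as a function of the index `i ≥ 1` (so `rget n r 1 = r_1`, etc.). -/
def rget (n : ℕ) (r : Fin n → ℕ) (i : ℕ) : ℕ :=
  if h : i - 1 < n then r ⟨i - 1, h⟩ else 0

/-- `C_r = δ(r)·r_2(r_2−1)(r_1+1)(r_1+2)/(2^{r_2+1}·r_1!·r_2!)`. -/
def splitCr (n : ℕ) (r : Fin n → ℕ) : ℝ :=
  splitDelta n r *
    ((rget n r 2 : ℝ) * ((rget n r 2 : ℝ) - 1) *
      ((rget n r 1 : ℝ) + 1) * ((rget n r 1 : ℝ) + 2)) /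
    ((2 : ℝ) ^ (rget n r 2 + 1) * (Nat.factorial (rget n r 1) : ℝ) *
      (Nat.factorial (rget n r 2) : ℝ))

/-- `C_{k,r} = (δ(r)−δ(r)²)^{k/2}·k!/(2^{k/2}(k/2)!)` for even `k`. -/
def CkrEven (n : ℕ) (r : Fin n → ℕ) (k : ℕ) : ℝ :=
  (splitDelta n r - splitDelta n r ^ 2) ^ (k / 2) * (Nat.factorial k : ℝ) /
    ((2 : ℝ) ^ (k / 2) * (Nat.factorial (k / 2) : ℝ))

/-- A recursion of the shape satisfied by the moments of a sum of independent variables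
indexed by `S₀`, whose first moments are `O(1/p)`: growth of the solution. -/
lemma momentRec_abs_le {S₀ : Finset ℕ} {M : Finset ℕ → ℕ → ℝ} {μ : ℕ → ℕ → ℝ} {A : ℝ}
    {k : ℕ} (hA : 0 ≤ A) (hM0 : ∀ S ⊆ S₀, M S 0 = 1) (hMempty : ∀ j, j ≠ 0 → M ∅ j = 0)
    (hrec : ∀ S p, p ∉ S → insert p S ⊆ S₀ → ∀ j, M (insert p S) j =
      ∑ i ∈ range (j + 1), M S i * μ p (j - i) * (j.choose i : ℝ))
    (hμ0 : ∀ p ∈ S₀, μ p 0 = 1) (hμ : ∀ p ∈ S₀, ∀ i, |μ p i| ≤ 1)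
    (hμ1 : ∀ p ∈ S₀, |μ p 1| ≤ A * (1 / (p : ℝ)))
    {D : ℝ} (hD : D = k * A * ∑ p ∈ S₀, 1 / (p : ℝ) + 2 ^ k) :
    ∀ j ≤ k, ∀ S ⊆ S₀, |M S j| ≤ D ^ j * (#S₀ : ℝ) ^ (j / 2) := by
  have hH : ∀ S : Finset ℕ, 0 ≤ ∑ p ∈ S, 1 / (p : ℝ) :=
    fun S => sum_nonneg fun _ _ => by positivity
  have hD1 : 1 ≤ D := by
    have := one_le_pow₀ (M₀ := ℝ) one_le_two (n := k)
    have := mul_nonneg (mul_nonneg (Nat.cast_nonneg (α := ℝ) k) hA) (hH S₀)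
    rw [hD]; linarith
  intro j
  induction j using Nat.strong_induction_on with
  | _ j ih =>
  intro hjk
  rcases Nat.eq_zero_or_pos j with rfl | hj
  · intro S hS; simp [hM0 S hS]
  have key : ∀ S ⊆ S₀, |M S j| ≤ D ^ (j - 1) * (#S₀ : ℝ) ^ (j / 2) *
      (k * A * ∑ p ∈ S, 1 / (p : ℝ) + 2 ^ k * (#S / #S₀ : ℝ)) := by
    intro S
    induction S using Finset.induction_on with
    | empty => intro _; simp [hMempty j hj.ne']
    | insert p S hp ihS =>
      intro hS
      have hSS : S ⊆ S₀ := (subset_insert p S).trans hS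
      have hpS : p ∈ S₀ := hS (mem_insert_self p S)
      have hT : 1 ≤ (#S₀ : ℝ) := by
        exact_mod_cast Finset.card_pos.mpr ⟨p, hpS⟩
      have hT0 : 0 < (#S₀ : ℝ) := by linarith
      have h1 := ihS hSS
      obtain ⟨l, rfl⟩ : ∃ l, j = l + 1 := ⟨j - 1, by omega⟩
      rw [hrec S p hp hS, sum_range_succ, sum_range_succ]
      simp only [Nat.sub_self, hμ0 p hpS, Nat.choose_self, Nat.cast_one, mul_one,
        Nat.add_sub_cancel_left, Nat.add_sub_cancel]
      have h2 : |M S l * μ p 1 * ((l + 1).choose l : ℝ)| ≤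
          D ^ l * (#S₀ : ℝ) ^ ((l + 1) / 2) * (k * A * (1 / (p : ℝ))) := by
        rw [abs_mul, abs_mul, Nat.abs_cast, Nat.choose_succ_self_right]
        have e1 : |M S l| ≤ D ^ l * (#S₀ : ℝ) ^ ((l + 1) / 2) :=
          (ih l (by omega) (by omega) S hSS).trans (by gcongr; exact l.le_succ)
        have e2 : ((l + 1 : ℕ) : ℝ) ≤ k := by exact_mod_cast hjk
        calc |M S l| * |μ p 1| * ((l + 1 : ℕ) : ℝ)
            ≤ (D ^ l * (#S₀ : ℝ) ^ ((l + 1) / 2)) * (A * (1 / (p : ℝ))) * k := by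
              gcongr; exact hμ1 p hpS
          _ = _ := by ring
      have h3 : |∑ i ∈ range l, M S i * μ p (l + 1 - i) * ((l + 1).choose i : ℝ)| ≤
          D ^ l * (#S₀ : ℝ) ^ ((l + 1) / 2) * (2 ^ k * (1 / (#S₀ : ℝ))) := by
        have e1 : ∀ i ∈ range l, |M S i * μ p (l + 1 - i) * ((l + 1).choose i : ℝ)| ≤
            D ^ l * (#S₀ : ℝ) ^ ((l + 1) / 2) * (1 / (#S₀ : ℝ)) * ((l + 1).choose i : ℝ) := by
          intro i hi
          have hi := mem_range.mp hi
          rw [abs_mul, abs_mul, Nat.abs_cast]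
          refine mul_le_mul_of_nonneg_right ?_ (by positivity)
          have e2 : |M S i| ≤ D ^ l * (#S₀ : ℝ) ^ ((l + 1) / 2 - 1) := by
            refine (ih i (by omega) (by omega) S hSS).trans ?_
            gcongr <;> first | assumption | omega
          have e3 : (#S₀ : ℝ) ^ ((l + 1) / 2) = (#S₀ : ℝ) ^ ((l + 1) / 2 - 1) * #S₀ := by
            rw [← pow_succ]; congr 1; omega
          calc |M S i| * |μ p (l + 1 - i)|
              ≤ D ^ l * (#S₀ : ℝ) ^ ((l + 1) / 2 - 1) * 1 := by
                gcongr; exact hμ p hpS _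
            _ = _ := by rw [e3]; field_simp
        refine (abs_sum_le_sum_abs _ _).trans ((sum_le_sum e1).trans ?_)
        rw [← mul_sum, mul_assoc (D ^ l * _), mul_comm (2 ^ k : ℝ)]
        gcongr
        calc ∑ i ∈ range l, ((l + 1).choose i : ℝ)
            ≤ ∑ i ∈ range (l + 1 + 1), ((l + 1).choose i : ℝ) :=
              sum_le_sum_of_subset_of_nonneg (range_subset_range.mpr (by omega))
                fun _ _ _ => by positivity
          _ = 2 ^ (l + 1) := by exact_mod_cast Nat.sum_range_choose (l + 1)
          _ ≤ 2 ^ k := pow_le_pow_right₀ one_le_two hjk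
      rw [sum_insert hp, card_insert_of_notMem hp]
      simp only [Nat.add_sub_cancel] at h1
      push_cast
      calc _ ≤ _ + _ + _ := abs_add_three _ _ _
        _ ≤ _ := add_le_add (add_le_add h3 h2) h1
        _ = _ := by ring
  intro S hS
  refine (key S hS).trans ?_
  obtain ⟨l, rfl⟩ : ∃ l, j = l + 1 := ⟨j - 1, by omega⟩
  rw [pow_succ D l, mul_right_comm, Nat.add_sub_cancel]
  gcongr
  rw [hD]
  have e1 : ∑ p ∈ S, 1 / (p : ℝ) ≤ ∑ p ∈ S₀, 1 / (p : ℝ) :=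
    sum_le_sum_of_subset_of_nonneg hS fun _ _ _ => by positivity
  have e2 : (#S / #S₀ : ℝ) ≤ 1 :=
    div_le_one_of_le₀ (by exact_mod_cast card_le_card hS) (by positivity)
  calc _ ≤ k * A * ∑ p ∈ S₀, 1 / (p : ℝ) + 2 ^ k * (1 : ℝ) := by gcongr
    _ = _ := by ring

/-- The even moments `v ^ m * (2m)! / (2 ^ m * m!)` of a Gaussian variable of variance `v`. -/
def gaussMoment (v : ℝ) (m : ℕ) : ℝ :=
  v ^ m * (Nat.factorial (2 * m) : ℝ) / (2 ^ m * (Nat.factorial m : ℝ))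

lemma gaussMoment_zero (v : ℝ) : gaussMoment v 0 = 1 := by simp [gaussMoment]

lemma gaussMoment_succ (v : ℝ) (m : ℕ) :
    gaussMoment v (m + 1) * (m + 1) =
      ((2 * (m + 1)).choose (2 * m) : ℝ) * v * gaussMoment v m := by
  have h1 : ((2 * (m + 1)).choose (2 * m) : ℝ) = (2 * m + 1) * (m + 1) := by
    have : (2 * (m + 1)).choose (2 * m) = (2 * m + 1) * (m + 1) := by
      rw [show 2 * (m + 1) = 2 * m + 2 by ring, Nat.choose_symm_add, Nat.choose_two_right]
      rw [show 2 * m + 2 - 1 = 2 * m + 1 by omega,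
        show (2 * m + 2) * (2 * m + 1) = (2 * m + 1) * (m + 1) * 2 by ring,
        Nat.mul_div_cancel _ two_pos]
    rw [this]; push_cast; ring
  rw [h1, gaussMoment, gaussMoment, show 2 * (m + 1) = 2 * m + 1 + 1 by ring]
  rw [Nat.factorial_succ, Nat.factorial_succ, Nat.factorial_succ m]
  push_cast
  have : (Nat.factorial m : ℝ) ≠ 0 := by positivity
  field_simp
  ring

lemma gaussMoment_nonneg {v : ℝ} (hv : 0 ≤ v) (m : ℕ) : 0 ≤ gaussMoment v m := by
  unfold gaussMoment; positivity

lemma gaussMoment_le {v : ℝ} (hv : 0 ≤ v) (hv1 : v ≤ 1) (m : ℕ) :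
    gaussMoment v m ≤ (Nat.factorial (2 * m) : ℝ) := by
  unfold gaussMoment
  have h1 : (1 : ℝ) ≤ 2 ^ m * (Nat.factorial m : ℝ) :=
    one_le_mul_of_one_le_of_one_le (one_le_pow₀ one_le_two)
      (by exact_mod_cast Nat.factorial_pos m)
  rw [div_le_iff₀ (by positivity)]
  have h2 : v ^ m ≤ 1 := pow_le_one₀ hv hv1
  have h3 : (0 : ℝ) ≤ (Nat.factorial (2 * m) : ℝ) := by positivity
  nlinarith

lemma le_gaussMoment {v : ℝ} (hv : 0 ≤ v) (m : ℕ) : v ^ m ≤ gaussMoment v m := by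
  unfold gaussMoment
  rw [le_div_iff₀ (by positivity)]
  gcongr
  have : 2 ^ m * m.factorial ≤ (2 * m).factorial := by
    induction m with
    | zero => simp
    | succ m ih =>
      rw [show 2 * (m + 1) = 2 * m + 1 + 1 by ring, Nat.factorial_succ (2 * m + 1),
        Nat.factorial_succ (2 * m), Nat.factorial_succ m, pow_succ]
      calc 2 ^ m * 2 * ((m + 1) * m.factorial) = (2 * m + 2) * (2 ^ m * m.factorial) := by ring
        _ ≤ (2 * m + 2) * (2 * m).factorial := by gcongr
        _ ≤ (2 * m + 1 + 1) * ((2 * m + 1) * (2 * m).factorial) := by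
          gcongr
          exact Nat.le_mul_of_pos_left _ (by omega)
  exact_mod_cast this

/-- Second order expansion of `(s + 1) ^ m`. -/
lemma abs_succ_pow_sub_le {s T : ℕ} (hs : s + 1 ≤ T) (m : ℕ) :
    |((s : ℝ) + 1) ^ (m + 1) - (s : ℝ) ^ (m + 1) - (m + 1) * (s : ℝ) ^ m| * T ^ 2 ≤
      2 ^ (m + 1) * (T : ℝ) ^ (m + 1) := by
  have hT : 1 ≤ (T : ℝ) := by exact_mod_cast (by omega : 1 ≤ T)
  have hsT : (s : ℝ) ≤ T := by exact_mod_cast (by omega : s ≤ T)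
  rw [add_pow, sum_range_succ, sum_range_succ]
  have : ∑ x ∈ range m, (s : ℝ) ^ x * 1 ^ (m + 1 - x) * ((m + 1).choose x : ℝ) +
      (s : ℝ) ^ m * 1 ^ (m + 1 - m) * ((m + 1).choose m : ℝ) +
      (s : ℝ) ^ (m + 1) * 1 ^ (m + 1 - (m + 1)) * ((m + 1).choose (m + 1) : ℝ)
      - (s : ℝ) ^ (m + 1) - (m + 1) * (s : ℝ) ^ m =
      ∑ x ∈ range m, (s : ℝ) ^ x * ((m + 1).choose x : ℝ) := by
    simp [Nat.choose_succ_self_right]; ring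
  rw [this, abs_of_nonneg (sum_nonneg fun _ _ => by positivity), sum_mul]
  calc ∑ x ∈ range m, (s : ℝ) ^ x * ((m + 1).choose x : ℝ) * T ^ 2
      ≤ ∑ x ∈ range m, (T : ℝ) ^ (m + 1) * ((m + 1).choose x : ℝ) := by
        refine sum_le_sum fun x hx => ?_
        have hx := mem_range.mp hx
        rw [mul_right_comm]
        gcongr
        calc (s : ℝ) ^ x * T ^ 2 ≤ (T : ℝ) ^ x * T ^ 2 := by gcongr
          _ = (T : ℝ) ^ (x + 2) := by rw [pow_add]
          _ ≤ (T : ℝ) ^ (m + 1) := pow_le_pow_right₀ hT (by omega)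
    _ = (∑ x ∈ range m, ((m + 1).choose x : ℝ)) * (T : ℝ) ^ (m + 1) := by
        rw [← mul_sum, mul_comm]
    _ ≤ _ := by
        gcongr
        calc ∑ i ∈ range m, ((m + 1).choose i : ℝ)
            ≤ ∑ i ∈ range (m + 1 + 1), ((m + 1).choose i : ℝ) :=
              sum_le_sum_of_subset_of_nonneg (range_subset_range.mpr (by omega))
                fun _ _ _ => by positivity
          _ = 2 ^ (m + 1) := by exact_mod_cast Nat.sum_range_choose (m + 1)


/-- Even moments in the setting of `momentRec_abs_le`, when the second moments are
`v + O(1/p)`: the solution is close to the moments of a Gaussian variable. -/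
lemma momentRec_even {S₀ : Finset ℕ} {M : Finset ℕ → ℕ → ℝ} {μ : ℕ → ℕ → ℝ} {A v : ℝ}
    {k : ℕ} (hA : 0 ≤ A) (hM0 : ∀ S ⊆ S₀, M S 0 = 1) (hMempty : ∀ j, j ≠ 0 → M ∅ j = 0)
    (hrec : ∀ S p, p ∉ S → insert p S ⊆ S₀ → ∀ j, M (insert p S) j =
      ∑ i ∈ range (j + 1), M S i * μ p (j - i) * (j.choose i : ℝ))
    (hμ0 : ∀ p ∈ S₀, μ p 0 = 1) (hμ : ∀ p ∈ S₀, ∀ i, |μ p i| ≤ 1)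
    (hμ1 : ∀ p ∈ S₀, |μ p 1| ≤ A * (1 / (p : ℝ)))
    (hμ2 : ∀ p ∈ S₀, |μ p 2 - v| ≤ A * (1 / (p : ℝ))) (hv : 0 ≤ v) (hv1 : v ≤ 1)
    {D : ℝ} (hD : D = k * A * ∑ p ∈ S₀, 1 / (p : ℝ) + 2 ^ k)
    {G : ℝ} (hG : G = 2 ^ k * (2 * A * D ^ k * ∑ p ∈ S₀, 1 / (p : ℝ) + 1 + D ^ k +
      Nat.factorial k)) :
    ∀ m, 2 * m ≤ k → ∀ S ⊆ S₀,
      #S₀ * |M S (2 * m) - gaussMoment v m * (#S : ℝ) ^ m| ≤ G ^ m * (#S₀ : ℝ) ^ m := by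
  have hH : ∀ S : Finset ℕ, 0 ≤ ∑ p ∈ S, 1 / (p : ℝ) :=
    fun S => sum_nonneg fun _ _ => by positivity
  have h2k : (1 : ℝ) ≤ 2 ^ k := one_le_pow₀ one_le_two
  have hD1 : 1 ≤ D := by
    have := mul_nonneg (mul_nonneg (Nat.cast_nonneg (α := ℝ) k) hA) (hH S₀)
    rw [hD]; linarith
  have hDk : 1 ≤ D ^ k := one_le_pow₀ hD1
  have hG1 : 1 ≤ G := by
    have h1 := mul_nonneg (mul_nonneg (mul_nonneg zero_le_two hA) (zero_le_one.trans hDk)) (hH S₀)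
    have h2 : (0 : ℝ) ≤ Nat.factorial k := by positivity
    rw [hG]; nlinarith
  have hbd := momentRec_abs_le hA hM0 hMempty hrec hμ0 hμ hμ1 hD
  intro m
  induction m with
  | zero =>
    intro _ S hS
    simp [hM0 S hS, gaussMoment_zero]
  | succ m ih =>
  intro hmk
  have key : ∀ S ⊆ S₀, #S₀ * |M S (2 * (m + 1)) - gaussMoment v (m + 1) * (#S : ℝ) ^ (m + 1)| ≤
      G ^ m * (#S₀ : ℝ) ^ (m + 1) * (2 ^ k * (2 * A * D ^ k) * ∑ p ∈ S, 1 / (p : ℝ) +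
        2 ^ k * (1 + D ^ k + Nat.factorial k) * (#S / #S₀ : ℝ)) := by
    intro S
    induction S using Finset.induction_on with
    | empty => intro _; simp [hMempty]
    | insert p S hp ihS =>
      intro hS
      have hSS : S ⊆ S₀ := (subset_insert p S).trans hS
      have hpS : p ∈ S₀ := hS (mem_insert_self p S)
      have hcard : #S + 1 ≤ #S₀ := by
        rw [← card_insert_of_notMem hp]; exact card_le_card hS
      have hT : 1 ≤ (#S₀ : ℝ) := by
        exact_mod_cast Finset.card_pos.mpr ⟨p, hpS⟩
      set T : ℝ := (#S₀ : ℝ) with hTdef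
      have hT0 : 0 < T := by linarith
      have hGm : 1 ≤ G ^ m := one_le_pow₀ hG1
      have h1 := ihS hSS
      have hch : ∀ i, ((2 * m + 2).choose i : ℝ) ≤ 2 ^ k := fun i => by
        have := (Nat.choose_le_two_pow (2 * m + 2) i).trans
          (Nat.pow_le_pow_right two_pos (by omega : 2 * m + 2 ≤ k))
        exact_mod_cast this
      have hsplit : M (insert p S) (2 * m + 2) =
          ∑ i ∈ range (2 * m), M S i * μ p (2 * m + 2 - i) * ((2 * m + 2).choose i : ℝ) +
          M S (2 * m) * μ p 2 * ((2 * m + 2).choose (2 * m) : ℝ) +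
          M S (2 * m + 1) * μ p 1 * ((2 * m + 2).choose (2 * m + 1) : ℝ) + M S (2 * m + 2) := by
        rw [hrec S p hp hS, sum_range_succ, sum_range_succ, sum_range_succ]
        simp [hμ0 p hpS]
      have hrest : T * |∑ i ∈ range (2 * m), M S i * μ p (2 * m + 2 - i) *
          ((2 * m + 2).choose i : ℝ)| ≤ G ^ m * T ^ (m + 1) * (2 ^ k * D ^ k * (1 / T)) := by
        have e1 : ∀ i ∈ range (2 * m), |M S i * μ p (2 * m + 2 - i) *
            ((2 * m + 2).choose i : ℝ)| ≤ D ^ k * T ^ (m - 1) * ((2 * m + 2).choose i : ℝ) := by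
          intro i hi
          have hi := mem_range.mp hi
          rw [abs_mul, abs_mul, Nat.abs_cast]
          refine mul_le_mul_of_nonneg_right ?_ (by positivity)
          have e2 : |M S i| ≤ D ^ k * T ^ (m - 1) := by
            refine (hbd i (by omega) S hSS).trans ?_
            gcongr <;> first | assumption | omega
          calc |M S i| * |μ p (2 * m + 2 - i)|
              ≤ D ^ k * T ^ (m - 1) * 1 := by
                gcongr; exact hμ p hpS _
            _ = _ := by ring
        rcases Nat.eq_zero_or_pos m with rfl | hm
        · simp; positivity
        have e3 : T ^ (m + 1) = T ^ (m - 1) * T * T := by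
          rw [← pow_succ, ← pow_succ]; congr 1; omega
        have e4 : ∑ i ∈ range (2 * m), ((2 * m + 2).choose i : ℝ) ≤ 2 ^ k :=
          calc ∑ i ∈ range (2 * m), ((2 * m + 2).choose i : ℝ)
              ≤ ∑ i ∈ range (2 * m + 2 + 1), ((2 * m + 2).choose i : ℝ) :=
                sum_le_sum_of_subset_of_nonneg (range_subset_range.mpr (by omega))
                  fun _ _ _ => by positivity
            _ = 2 ^ (2 * m + 2) := by exact_mod_cast Nat.sum_range_choose (2 * m + 2)
            _ ≤ 2 ^ k := pow_le_pow_right₀ one_le_two (by omega)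
        calc T * |_| ≤ T * (D ^ k * T ^ (m - 1) * 2 ^ k) := by
              refine mul_le_mul_of_nonneg_left ?_ hT0.le
              refine (abs_sum_le_sum_abs _ _).trans ((sum_le_sum e1).trans ?_)
              rw [← mul_sum]
              gcongr
          _ = 1 * T ^ (m + 1) * (2 ^ k * D ^ k * (1 / T)) := by
              rw [e3]; field_simp
          _ ≤ _ := by gcongr
      have hfirst : T * |M S (2 * m + 1) * μ p 1 * ((2 * m + 2).choose (2 * m + 1) : ℝ)| ≤
          G ^ m * T ^ (m + 1) * (2 ^ k * (A * D ^ k) * (1 / (p : ℝ))) := by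
        rw [abs_mul, abs_mul, Nat.abs_cast]
        have e2 : |M S (2 * m + 1)| ≤ D ^ k * T ^ m := by
          refine (hbd _ (by omega) S hSS).trans ?_
          gcongr <;> first | assumption | omega
        calc T * (|M S (2 * m + 1)| * |μ p 1| * ((2 * m + 2).choose (2 * m + 1) : ℝ))
            ≤ T * ((D ^ k * T ^ m) * (A * (1 / (p : ℝ))) * 2 ^ k) := by
              gcongr
              · exact hμ1 p hpS
              · exact hch _
          _ = 1 * T ^ (m + 1) * (2 ^ k * (A * D ^ k) * (1 / (p : ℝ))) := by ring
          _ ≤ _ := by gcongr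
      have hsecond : T * |M S (2 * m) * μ p 2 * ((2 * m + 2).choose (2 * m) : ℝ) -
            ((2 * m + 2).choose (2 * m) : ℝ) * v * (gaussMoment v m * (#S : ℝ) ^ m)| ≤
          G ^ m * T ^ (m + 1) * (2 ^ k * (A * D ^ k) * (1 / (p : ℝ))) +
          G ^ m * T ^ (m + 1) * (2 ^ k * (1 / T)) := by
        have e1 : M S (2 * m) * μ p 2 * ((2 * m + 2).choose (2 * m) : ℝ) -
            ((2 * m + 2).choose (2 * m) : ℝ) * v * (gaussMoment v m * (#S : ℝ) ^ m) =
            ((2 * m + 2).choose (2 * m) : ℝ) * (M S (2 * m) * (μ p 2 - v) +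
              v * (M S (2 * m) - gaussMoment v m * (#S : ℝ) ^ m)) := by ring
        have e2 : |M S (2 * m)| ≤ D ^ k * T ^ m := by
          refine (hbd _ (by omega) S hSS).trans ?_
          gcongr <;> first | assumption | omega
        have e3 := ih (by omega) S hSS
        rw [e1, abs_mul, Nat.abs_cast]
        calc T * (((2 * m + 2).choose (2 * m) : ℝ) * |M S (2 * m) * (μ p 2 - v) +
              v * (M S (2 * m) - gaussMoment v m * (#S : ℝ) ^ m)|)
            ≤ T * (2 ^ k * (D ^ k * T ^ m * (A * (1 / (p : ℝ))) +
              1 * |M S (2 * m) - gaussMoment v m * (#S : ℝ) ^ m|)) := by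
              gcongr
              · exact hch _
              · refine (abs_add_le _ _).trans ?_
                rw [abs_mul, abs_mul, abs_of_nonneg hv]
                gcongr
                exact hμ2 p hpS
          _ = 1 * T ^ (m + 1) * (2 ^ k * (A * D ^ k) * (1 / (p : ℝ))) +
              2 ^ k * (T * |M S (2 * m) - gaussMoment v m * (#S : ℝ) ^ m|) := by ring
          _ ≤ G ^ m * T ^ (m + 1) * (2 ^ k * (A * D ^ k) * (1 / (p : ℝ))) +
              2 ^ k * (G ^ m * T ^ m) := by gcongr
          _ = _ := by
            congr 1
            rw [pow_succ]; field_simp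
      have hpow : T * |gaussMoment v (m + 1) * (((#S : ℝ) + 1) ^ (m + 1) - (#S : ℝ) ^ (m + 1) -
          (m + 1) * (#S : ℝ) ^ m)| ≤
          G ^ m * T ^ (m + 1) * (2 ^ k * Nat.factorial k * (1 / T)) := by
        have e1 := abs_succ_pow_sub_le hcard m
        have e2 : gaussMoment v (m + 1) ≤ Nat.factorial k :=
          (gaussMoment_le hv hv1 _).trans (by exact_mod_cast Nat.factorial_le hmk)
        have e3 : (2 : ℝ) ^ (m + 1) ≤ 2 ^ k := pow_le_pow_right₀ one_le_two (by omega)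
        rw [abs_mul, abs_of_nonneg (gaussMoment_nonneg hv _)]
        rw [← hTdef] at e1
        have hR := abs_nonneg
          (((#S : ℝ) + 1) ^ (m + 1) - (#S : ℝ) ^ (m + 1) - (m + 1) * (#S : ℝ) ^ m)
        generalize |((#S : ℝ) + 1) ^ (m + 1) - (#S : ℝ) ^ (m + 1) - (m + 1) * (#S : ℝ) ^ m| = R
          at e1 hR ⊢
        calc T * (gaussMoment v (m + 1) * R) = gaussMoment v (m + 1) * (R * T ^ 2) * (1 / T) := by
              field_simp
          _ ≤ Nat.factorial k * (2 ^ k * T ^ (m + 1)) * (1 / T) := by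
              have e4 : R * T ^ 2 ≤ 2 ^ k * T ^ (m + 1) := e1.trans (by gcongr)
              have e5 := gaussMoment_nonneg hv (m + 1)
              exact mul_le_mul_of_nonneg_right (mul_le_mul e2 e4 (by positivity) (by positivity))
                (by positivity)
          _ = 1 * T ^ (m + 1) * (2 ^ k * Nat.factorial k * (1 / T)) := by ring
          _ ≤ _ := by gcongr
      rw [sum_insert hp, card_insert_of_notMem hp]
      push_cast
      have hid : M (insert p S) (2 * (m + 1)) - gaussMoment v (m + 1) * ((#S : ℝ) + 1) ^ (m + 1) =
          ∑ i ∈ range (2 * m), M S i * μ p (2 * m + 2 - i) * ((2 * m + 2).choose i : ℝ) +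
          (M S (2 * m) * μ p 2 * ((2 * m + 2).choose (2 * m) : ℝ) -
            ((2 * m + 2).choose (2 * m) : ℝ) * v * (gaussMoment v m * (#S : ℝ) ^ m)) +
          M S (2 * m + 1) * μ p 1 * ((2 * m + 2).choose (2 * m + 1) : ℝ) +
          (M S (2 * (m + 1)) - gaussMoment v (m + 1) * (#S : ℝ) ^ (m + 1)) -
          gaussMoment v (m + 1) * (((#S : ℝ) + 1) ^ (m + 1) - (#S : ℝ) ^ (m + 1) -
            (m + 1) * (#S : ℝ) ^ m) := by
        have e1 := gaussMoment_succ v m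
        rw [show 2 * (m + 1) = 2 * m + 2 by ring] at e1 ⊢
        rw [hsplit]
        linear_combination (-(#S : ℝ) ^ m) * e1
      rw [hid]
      generalize (∑ i ∈ range (2 * m), M S i * μ p (2 * m + 2 - i) *
        ((2 * m + 2).choose i : ℝ)) = a₁ at *
      generalize (M S (2 * m) * μ p 2 * ((2 * m + 2).choose (2 * m) : ℝ) -
            ((2 * m + 2).choose (2 * m) : ℝ) * v * (gaussMoment v m * (#S : ℝ) ^ m)) = a₂ at *
      generalize M S (2 * m + 1) * μ p 1 * ((2 * m + 2).choose (2 * m + 1) : ℝ) = a₃ at *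
      generalize M S (2 * (m + 1)) - gaussMoment v (m + 1) * (#S : ℝ) ^ (m + 1) = a₄ at *
      generalize gaussMoment v (m + 1) * (((#S : ℝ) + 1) ^ (m + 1) - (#S : ℝ) ^ (m + 1) -
            (m + 1) * (#S : ℝ) ^ m) = a₅ at *
      have habs : |a₁ + a₂ + a₃ + a₄ - a₅| ≤ |a₁| + |a₂| + |a₃| + |a₄| + |a₅| :=
        (abs_sub _ _).trans (add_le_add ((abs_add_le _ _).trans
          (add_le_add (abs_add_three _ _ _) le_rfl)) le_rfl)
      calc T * |a₁ + a₂ + a₃ + a₄ - a₅|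
          ≤ T * (|a₁| + |a₂| + |a₃| + |a₄| + |a₅|) := by gcongr
        _ = T * |a₁| + T * |a₂| + T * |a₃| + T * |a₄| + T * |a₅| := by ring
        _ ≤ _ := add_le_add (add_le_add (add_le_add (add_le_add hrest hsecond) hfirst) h1) hpow
        _ = _ := by ring
  intro S hS
  refine (key S hS).trans ?_
  rw [pow_succ G m, mul_right_comm]
  gcongr
  rw [hG]
  have e1 : ∑ p ∈ S, 1 / (p : ℝ) ≤ ∑ p ∈ S₀, 1 / (p : ℝ) :=
    sum_le_sum_of_subset_of_nonneg hS fun _ _ _ => by positivity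
  have e2 : (#S / #S₀ : ℝ) ≤ 1 :=
    div_le_one_of_le₀ (by exact_mod_cast card_le_card hS) (by positivity)
  calc _ ≤ 2 ^ k * (2 * A * D ^ k) * ∑ p ∈ S₀, 1 / (p : ℝ) +
        2 ^ k * (1 + D ^ k + Nat.factorial k) * (1 : ℝ) := by gcongr
    _ = _ := by ring

/-- A function of an integer vector that only depends on its residue modulo `Q`. -/
def PeriodicMod {n : ℕ} (Q : ℕ) (F : (Fin n → ℤ) → ℝ) : Prop :=
  ∀ a b : Fin n → ℤ, (∀ i, a i ≡ b i [ZMOD Q]) → F a = F b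

/-- The mean value of `F` over a full system of residues modulo `Q`. -/
def residueMean {n : ℕ} (Q : ℕ) (F : (Fin n → ℤ) → ℝ) : ℝ :=
  (∑ c ∈ Fintype.piFinset fun _ : Fin n => range Q, F fun i => (c i : ℤ)) / (Q : ℝ) ^ n

/-- The mean value of `F` over the box `coeffBox n N`. -/
def boxMean {n : ℕ} (N : ℕ) (F : (Fin n → ℤ) → ℝ) : ℝ :=
  (∑ a ∈ coeffBox n N, F a) / (2 * N + 1 : ℝ) ^ n

section PeriodicMod

variable {n : ℕ} {Q P : ℕ} {F G : (Fin n → ℤ) → ℝ}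

lemma PeriodicMod.mono (hF : PeriodicMod Q F) (h : Q ∣ P) : PeriodicMod P F :=
  fun a b hab => hF a b fun i => (hab i).of_dvd (by exact_mod_cast h)

lemma PeriodicMod.pow (hF : PeriodicMod Q F) (j : ℕ) : PeriodicMod Q fun a => F a ^ j :=
  fun a b hab => by simp only [hF a b hab]

lemma PeriodicMod.sum {ι : Type*} {s : Finset ι} {F : ι → (Fin n → ℤ) → ℝ}
    (hF : ∀ i ∈ s, PeriodicMod Q (F i)) : PeriodicMod Q fun a => ∑ i ∈ s, F i a :=
  fun a b hab => sum_congr rfl fun i hi => hF i hi a b hab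

lemma PeriodicMod.prod {ι : Type*} {s : Finset ι} {F : ι → (Fin n → ℤ) → ℝ}
    (hF : ∀ i ∈ s, PeriodicMod Q (F i)) : PeriodicMod Q fun a => ∏ i ∈ s, F i a :=
  fun a b hab => prod_congr rfl fun i hi => hF i hi a b hab

lemma residueMean_const (hQ : Q ≠ 0) (c : ℝ) :
    residueMean Q (fun _ : Fin n → ℤ => c) = c := by
  have : (Q : ℝ) ≠ 0 := by exact_mod_cast hQ
  simp only [residueMean, sum_const, Fintype.card_piFinset, card_range, prod_const, card_univ,
    Fintype.card_fin, nsmul_eq_mul, Nat.cast_pow]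
  field_simp

lemma abs_residueMean_le {B : ℝ} (hQ : Q ≠ 0) (hF : ∀ a, |F a| ≤ B) : |residueMean Q F| ≤ B := by
  have hQ' : (0 : ℝ) < Q := by exact_mod_cast Nat.pos_of_ne_zero hQ
  rw [residueMean, abs_div, abs_of_nonneg (by positivity : (0 : ℝ) ≤ (Q : ℝ) ^ n),
    div_le_iff₀ (by positivity)]
  refine (abs_sum_le_sum_abs _ _).trans ((sum_le_sum fun c _ => hF _).trans ?_)
  simp [mul_comm]

lemma residueMean_sum {ι : Type*} (s : Finset ι) (F : ι → (Fin n → ℤ) → ℝ) :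
    residueMean Q (fun a => ∑ i ∈ s, F i a) = ∑ i ∈ s, residueMean Q (F i) := by
  simp only [residueMean, ← sum_div]
  rw [sum_comm]

lemma residueMean_mul_const (c : ℝ) :
    residueMean Q (fun a => F a * c) = residueMean Q F * c := by
  simp only [residueMean, ← sum_mul]
  ring

lemma boxMean_sum {N : ℕ} {ι : Type*} (s : Finset ι) (F : ι → (Fin n → ℤ) → ℝ) :
    boxMean N (fun a => ∑ i ∈ s, F i a) = ∑ i ∈ s, boxMean N (F i) := by
  simp only [boxMean, ← sum_div]
  rw [sum_comm]

/-- Independence of residues modulo coprime integers. -/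
lemma residueMean_mul (hQ : Q ≠ 0) (hP : P ≠ 0) (hQP : Q.Coprime P) (hF : PeriodicMod Q F)
    (hG : PeriodicMod P G) :
    residueMean (Q * P) (fun a => F a * G a) = residueMean Q F * residueMean P G := by
  rw [residueMean, residueMean, residueMean, div_mul_div_comm, ← mul_pow, Nat.cast_mul,
    sum_mul_sum, ← sum_product']
  congr 1
  refine sum_nbij' (fun c => (fun k => c k % Q, fun k => c k % P))
    (fun d k => (Nat.chineseRemainder hQP (d.1 k) (d.2 k) : ℕ)) ?_ ?_ ?_ ?_ ?_
  · intro c _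
    simp only [mem_product, Fintype.mem_piFinset, mem_range]
    exact ⟨fun i => Nat.mod_lt _ (Nat.pos_of_ne_zero hQ),
      fun i => Nat.mod_lt _ (Nat.pos_of_ne_zero hP)⟩
  · intro d _
    simp only [Fintype.mem_piFinset, mem_range]
    exact fun i => Nat.chineseRemainder_lt_mul hQP _ _ hQ hP
  · intro c hc
    simp only [Fintype.mem_piFinset, mem_range] at hc
    funext k
    have h := (Nat.chineseRemainder hQP (c k % Q) (c k % P)).2
    have h' := (Nat.modEq_and_modEq_iff_modEq_mul hQP).mp
      ⟨h.1.trans (Nat.mod_modEq _ _), h.2.trans (Nat.mod_modEq _ _)⟩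
    exact Nat.ModEq.eq_of_lt_of_lt h' (Nat.chineseRemainder_lt_mul hQP _ _ hQ hP) (hc k)
  · rintro ⟨d, e⟩ hd
    simp only [mem_product, Fintype.mem_piFinset, mem_range] at hd
    refine Prod.ext ?_ ?_
    · funext k
      exact Nat.mod_eq_of_modEq (Nat.chineseRemainder hQP (d k) (e k)).2.1 (hd.1 k)
    · funext k
      exact Nat.mod_eq_of_modEq (Nat.chineseRemainder hQP (d k) (e k)).2.2 (hd.2 k)
  · intro c _
    congr 1
    · refine hF _ _ fun i => ?_
      exact (Int.natCast_modEq_iff.mpr (Nat.mod_modEq (c i) Q)).symm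
    · refine hG _ _ fun i => ?_
      exact (Int.natCast_modEq_iff.mpr (Nat.mod_modEq (c i) P)).symm

lemma residueMean_mul_left (hQ : Q ≠ 0) (hP : P ≠ 0) (hQP : Q.Coprime P)
    (hF : PeriodicMod Q F) : residueMean (Q * P) F = residueMean Q F := by
  have := residueMean_mul hQ hP hQP hF (G := fun _ => 1) (fun _ _ _ => rfl)
  simpa [residueMean_const hP] using this

end PeriodicMod

/-- Number of integers of `{-N, …, N}` in a residue class modulo `Q`. -/
lemma abs_card_residue_sub_le {N Q b : ℕ} (hQ : 0 < Q) :
    |(#((Icc (-(N : ℤ)) N).filter fun t => t ≡ b [ZMOD Q]) : ℝ) - (2 * N + 1) / Q| ≤ 1 := by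
  have h := Int.Ioc_filter_modEq_card (-(N : ℤ) - 1) N (Int.natCast_pos.mpr hQ) b
  have hset : Ioc (-(N : ℤ) - 1) N = Icc (-(N : ℤ)) N := by
    ext t; simp only [mem_Ioc, mem_Icc]; omega
  rw [hset] at h
  have hQ' : (0 : ℚ) < Q := by exact_mod_cast hQ
  push_cast at h
  set u : ℚ := (N - b) / Q
  set w : ℚ := (-N - 1 - b) / Q
  have huw : u - w = (2 * N + 1) / Q := by simp only [u, w]; field_simp; ring
  have hwu : w ≤ u := by
    have : 0 ≤ u - w := by rw [huw]; positivity
    linarith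
  rw [max_eq_left (sub_nonneg.mpr (Int.floor_le_floor hwu))] at h
  have hq : |((⌊u⌋ - ⌊w⌋ : ℤ) : ℚ) - (2 * N + 1) / Q| ≤ 1 := by
    rw [← huw, abs_le]
    push_cast
    constructor <;>
      linarith [Int.floor_le u, Int.floor_le w, Int.lt_floor_add_one u, Int.lt_floor_add_one w]
  rw [← h] at hq
  have := (Rat.cast_le (K := ℝ)).mpr hq
  push_cast at this
  convert this

lemma abs_prod_sub_one_le {ι : Type*} (s : Finset ι) {z : ι → ℝ} {ε : ℝ}
    (hε1 : ε ≤ 1) (hz : ∀ i ∈ s, |z i - 1| ≤ ε) :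
    |∏ i ∈ s, z i - 1| ≤ (2 ^ #s - 1) * ε := by
  induction s using Finset.induction_on with
  | empty => simp
  | insert i s hi ih =>
    have h1 := ih fun j hj => hz j (mem_insert_of_mem hj)
    have h2 := hz i (mem_insert_self i s)
    rw [prod_insert hi, card_insert_of_notMem hi]
    have h3 : |z i| ≤ 2 := by
      have := abs_add_le (z i - 1) 1
      simp only [sub_add_cancel, abs_one] at this
      linarith
    calc |z i * ∏ j ∈ s, z j - 1| = |z i * (∏ j ∈ s, z j - 1) + (z i - 1)| := by ring_nf
      _ ≤ |z i| * |∏ j ∈ s, z j - 1| + |z i - 1| := by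
        rw [← abs_mul]; exact abs_add_le _ _
      _ ≤ 2 * ((2 ^ #s - 1) * ε) + ε := by gcongr
      _ = (2 ^ (#s + 1) - 1) * ε := by ring

/-- Equidistribution of the box `coeffBox n N` in residue classes. -/
lemma abs_boxMean_sub_residueMean_le {n N Q : ℕ} {F : (Fin n → ℤ) → ℝ} (hQ : 0 < Q)
    (hQN : Q ≤ 2 * N + 1) (hF : PeriodicMod Q F) {B : ℝ} (hB : ∀ a, |F a| ≤ B) :
    |boxMean N F - residueMean Q F| ≤ B * (2 ^ n * (Q / (2 * N + 1))) := by
  have hQ' : (0 : ℝ) < Q := by exact_mod_cast hQ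
  have hN' : (0 : ℝ) < 2 * N + 1 := by positivity
  set w : ℕ → ℕ := fun b => #((Icc (-(N : ℤ)) N).filter fun t => t ≡ b [ZMOD Q]) with hw
  have hsum : ∑ a ∈ coeffBox n N, F a =
      ∑ c ∈ Fintype.piFinset fun _ : Fin n => range Q,
        (F fun i => (c i : ℤ)) * ∏ i, (w (c i) : ℝ) := by
    rw [← sum_fiberwise_of_maps_to (s := coeffBox n N)
      (t := Fintype.piFinset fun _ : Fin n => range Q)
      (g := fun a i => (a i % (Q : ℤ)).toNat)]
    · refine sum_congr rfl fun c hc => ?_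
      simp only [Fintype.mem_piFinset, mem_range] at hc
      have hmod : ∀ a : Fin n → ℤ, (fun i => (a i % (Q : ℤ)).toNat) = c ↔
          ∀ i, a i ≡ c i [ZMOD Q] := by
        intro a
        rw [funext_iff]
        refine forall_congr' fun i => ?_
        have h0 := Int.emod_nonneg (a i) (by omega : (Q : ℤ) ≠ 0)
        have hc' : ((c i : ℤ)) % (Q : ℤ) = c i :=
          Int.emod_eq_of_lt (by omega) (by exact_mod_cast hc i)
        rw [Int.ModEq, hc']
        omega
      have hfib : (coeffBox n N).filter (fun a => (fun i => (a i % (Q : ℤ)).toNat) = c) =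
          Fintype.piFinset fun i => (Icc (-(N : ℤ)) N).filter fun t => t ≡ c i [ZMOD Q] := by
        ext a
        simp only [mem_filter, hmod, coeffBox, Fintype.mem_piFinset]
        exact forall_and.symm
      rw [sum_congr rfl (g := fun _ => F fun i => (c i : ℤ)), sum_const, hfib,
        Fintype.card_piFinset, nsmul_eq_mul, mul_comm, Nat.cast_prod]
      intro a ha
      exact hF _ _ ((hmod a).mp (mem_filter.mp ha).2)
    · intro a _
      simp only [Fintype.mem_piFinset, mem_range]
      intro i
      have h0 := Int.emod_nonneg (a i) (by omega : (Q : ℤ) ≠ 0)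
      have h1 := Int.emod_lt_of_pos (a i) (by omega : 0 < (Q : ℤ))
      omega
  have hε1 : (Q : ℝ) / (2 * N + 1) ≤ 1 := by
    rw [div_le_one hN']; exact_mod_cast hQN
  have hz : ∀ b, |(w b : ℝ) * (Q / (2 * N + 1)) - 1| ≤ Q / (2 * N + 1) := by
    intro b
    have h1 := abs_card_residue_sub_le (N := N) (b := b) hQ
    have h2 : (w b : ℝ) * (Q / (2 * N + 1)) - 1 =
        ((w b : ℝ) - (2 * N + 1) / Q) * (Q / (2 * N + 1)) := by field_simp
    rw [h2, abs_mul, abs_of_pos (by positivity : (0 : ℝ) < Q / (2 * N + 1))]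
    exact mul_le_of_le_one_left (by positivity) h1
  have hdiff : boxMean N F - residueMean Q F =
      (∑ c ∈ Fintype.piFinset fun _ : Fin n => range Q,
        (F fun i => (c i : ℤ)) * (∏ i, ((w (c i) : ℝ) * (Q / (2 * N + 1))) - 1)) / (Q : ℝ) ^ n := by
    rw [boxMean, residueMean, hsum]
    simp only [mul_sub, sum_sub_distrib, mul_one, sub_div, prod_mul_distrib, prod_const,
      card_univ, Fintype.card_fin]
    congr 1
    simp only [← mul_assoc, ← sum_mul, div_pow]
    field_simp
  rw [hdiff, abs_div, abs_of_pos (by positivity : (0 : ℝ) < (Q : ℝ) ^ n),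
    div_le_iff₀ (by positivity)]
  have hB0 : 0 ≤ B := (abs_nonneg _).trans (hB 0)
  calc |∑ c ∈ Fintype.piFinset fun _ : Fin n => range Q, (F fun i => (c i : ℤ)) *
        (∏ i, ((w (c i) : ℝ) * (Q / (2 * N + 1))) - 1)|
      ≤ ∑ c ∈ Fintype.piFinset fun _ : Fin n => range Q, B * (2 ^ n * (Q / (2 * N + 1))) := by
        refine (abs_sum_le_sum_abs _ _).trans (sum_le_sum fun c _ => ?_)
        rw [abs_mul]
        have h1 := abs_prod_sub_one_le (univ : Finset (Fin n))
          (z := fun i => (w (c i) : ℝ) * (Q / (2 * N + 1))) (ε := Q / (2 * N + 1))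
          hε1 fun i _ => hz _
        gcongr
        · exact hB _
        · refine h1.trans ?_
          gcongr
          simp
    _ = _ := by
        rw [sum_const, Fintype.card_piFinset]
        simp [mul_comm]

section Moments

variable {n : ℕ} {S₀ : Finset ℕ} {Y : ℕ → (Fin n → ℤ) → ℝ}

lemma prod_primes_ne_zero (hS₀ : ∀ p ∈ S₀, p.Prime) {S : Finset ℕ} (hS : S ⊆ S₀) :
    ∏ p ∈ S, p ≠ 0 :=
  prod_ne_zero_iff.mpr fun p hp => (hS₀ p (hS hp)).ne_zero

/-- The moments of `∑ p ∈ S, Y p` over residues satisfy the recursion of sums of independent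
variables. -/
lemma residueMean_moment_insert (hS₀ : ∀ p ∈ S₀, p.Prime) (hY : ∀ p ∈ S₀, PeriodicMod p (Y p))
    {S : Finset ℕ} {p : ℕ} (hp : p ∉ S) (hS : insert p S ⊆ S₀) (j : ℕ) :
    residueMean (∏ q ∈ insert p S, q) (fun a => (∑ q ∈ insert p S, Y q a) ^ j) =
      ∑ i ∈ range (j + 1), residueMean (∏ q ∈ S, q) (fun a => (∑ q ∈ S, Y q a) ^ i) *
        residueMean p (fun a => Y p a ^ (j - i)) * (j.choose i : ℝ) := by
  have hSS : S ⊆ S₀ := (subset_insert p S).trans hS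
  have hpS : p ∈ S₀ := hS (mem_insert_self p S)
  have h1 : (fun a => (∑ q ∈ insert p S, Y q a) ^ j) = fun a => ∑ i ∈ range (j + 1),
      (∑ q ∈ S, Y q a) ^ i * Y p a ^ (j - i) * (j.choose i : ℝ) := by
    funext a
    rw [sum_insert hp, add_comm, add_pow]
  rw [h1, residueMean_sum]
  refine sum_congr rfl fun i _ => ?_
  rw [residueMean_mul_const, prod_insert hp, mul_comm p]
  congr 1
  refine residueMean_mul (prod_primes_ne_zero hS₀ hSS) (hS₀ p hpS).ne_zero ?_ ?_ ?_
  · refine Nat.Coprime.prod_left fun q hq => ?_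
    exact (Nat.coprime_primes (hS₀ q (hSS hq)) (hS₀ p hpS)).mpr fun h => hp (h ▸ hq)
  · exact (PeriodicMod.sum fun q hq => (hY q (hSS hq)).mono (dvd_prod_of_mem _ hq)).pow i
  · exact (hY p hpS).pow _

/-- Comparison of the moments over the box with the moments over residues. -/
lemma abs_boxMean_moment_sub_le (hS₀ : ∀ p ∈ S₀, p.Prime) (hY : ∀ p ∈ S₀, PeriodicMod p (Y p))
    (hY1 : ∀ p ∈ S₀, ∀ a, |Y p a| ≤ 1) {x N k : ℕ} (hx : 1 ≤ x) (hS₀x : ∀ p ∈ S₀, p ≤ x)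
    (hxN : x ^ k ≤ 2 * N + 1) :
    |boxMean N (fun a => (∑ p ∈ S₀, Y p a) ^ k) -
      residueMean (∏ p ∈ S₀, p) (fun a => (∑ p ∈ S₀, Y p a) ^ k)| ≤
      (#S₀ : ℝ) ^ k * (2 ^ n * (x ^ k / (2 * N + 1))) := by
  have hexp : (fun a => (∑ p ∈ S₀, Y p a) ^ k) = fun a =>
      ∑ t ∈ Fintype.piFinset fun _ : Fin k => S₀, ∏ i, Y (t i) a := by
    funext a
    have h := prod_univ_sum (fun _ : Fin k => S₀) fun _ p => Y p a
    rw [prod_const, card_univ, Fintype.card_fin] at h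
    convert h
  rw [hexp, boxMean_sum, residueMean_sum, ← sum_sub_distrib]
  have hterm : ∀ t ∈ Fintype.piFinset fun _ : Fin k => S₀,
      |boxMean N (fun a => ∏ i, Y (t i) a) - residueMean (∏ p ∈ S₀, p) (fun a => ∏ i, Y (t i) a)|
        ≤ 2 ^ n * (x ^ k / (2 * N + 1)) := by
    intro t ht
    rw [Fintype.mem_piFinset] at ht
    set U : Finset ℕ := univ.image t with hU
    have hUS : U ⊆ S₀ := by
      intro p hp
      obtain ⟨i, _, rfl⟩ := mem_image.mp hp
      exact ht i
    have hper : PeriodicMod (∏ p ∈ U, p) (fun a => ∏ i, Y (t i) a) :=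
      PeriodicMod.prod fun i _ => (hY (t i) (ht i)).mono
        (dvd_prod_of_mem _ (mem_image_of_mem t (mem_univ i)))
    have hUx : ∏ p ∈ U, p ≤ x ^ k := by
      calc ∏ p ∈ U, p ≤ ∏ p ∈ U, x := prod_le_prod' fun p hp => hS₀x p (hUS hp)
        _ = x ^ #U := by simp
        _ ≤ x ^ k := Nat.pow_le_pow_right hx (by simpa using card_image_le (s := univ) (f := t))
    have hcop : (∏ p ∈ U, p).Coprime (∏ p ∈ S₀ \ U, p) := by
      refine Nat.Coprime.prod_left fun p hp => Nat.Coprime.prod_right fun q hq => ?_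
      have hq' := mem_sdiff.mp hq
      exact (Nat.coprime_primes (hS₀ p (hUS hp)) (hS₀ q hq'.1)).mpr fun h => hq'.2 (h ▸ hp)
    have hres : residueMean (∏ p ∈ S₀, p) (fun a => ∏ i, Y (t i) a) =
        residueMean (∏ p ∈ U, p) (fun a => ∏ i, Y (t i) a) := by
      rw [← prod_sdiff hUS, mul_comm]
      exact residueMean_mul_left (prod_primes_ne_zero hS₀ hUS)
        (prod_primes_ne_zero hS₀ sdiff_subset) hcop hper
    rw [hres]
    have hb : ∀ a, |∏ i, Y (t i) a| ≤ 1 := fun a => by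
      rw [abs_prod]
      exact prod_le_one (fun _ _ => abs_nonneg _) fun i _ => hY1 _ (ht i) a
    refine (abs_boxMean_sub_residueMean_le
      (Nat.pos_of_ne_zero (prod_primes_ne_zero hS₀ hUS)) (hUx.trans hxN) hper hb).trans ?_
    rw [one_mul]
    gcongr
    exact_mod_cast hUx
  refine (abs_sum_le_sum_abs _ _).trans ((sum_le_sum hterm).trans ?_)
  simp

end Moments

section IntPoly

variable {n : ℕ}

lemma sum_C_mul_X_pow_degree_lt {R : Type*} [CommRing R] (a : Fin n → R) :
    (∑ i : Fin n, C (a i) * X ^ (i : ℕ) : R[X]).degree < n :=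
  (degree_sum_fin_lt a)

lemma intPoly_map {R : Type*} [CommRing R] (φ : ℤ →+* R) (a : Fin n → ℤ) :
    (intPoly n a).map φ = X ^ n + ∑ i : Fin n, C (φ (a i)) * X ^ (i : ℕ) := by
  simp [intPoly, Polynomial.map_sum]

lemma intPoly_map_monic {R : Type*} [CommRing R] (φ : ℤ →+* R) (a : Fin n → ℤ) :
    ((intPoly n a).map φ).Monic := by
  rw [intPoly_map]
  exact monic_X_pow_add (sum_C_mul_X_pow_degree_lt _)

lemma intPoly_map_natDegree {R : Type*} [CommRing R] [Nontrivial R] (φ : ℤ →+* R)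
    (a : Fin n → ℤ) : ((intPoly n a).map φ).natDegree = n := by
  rw [intPoly_map]
  exact natDegree_eq_of_degree_eq_some
    ((degree_add_eq_left_of_degree_lt
      (by rw [degree_X_pow]; exact sum_C_mul_X_pow_degree_lt _)).trans (degree_X_pow n))

lemma intPoly_monic (a : Fin n → ℤ) : (intPoly n a).Monic := by
  simpa using intPoly_map_monic (RingHom.id ℤ) a

lemma intPoly_coeff (a : Fin n → ℤ) (i : Fin n) : (intPoly n a).coeff i = a i := by
  simp only [intPoly, coeff_add, coeff_X_pow, finsetSum_coeff, coeff_C_mul, mul_ite, mul_one,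
    mul_zero, i.2.ne, if_false, zero_add, Fin.val_inj]
  simp

lemma intPoly_map_eq_of_coeff {R : Type*} [CommRing R] [Nontrivial R] (φ : ℤ →+* R)
    {a : Fin n → ℤ} {g : R[X]} (hg : g.Monic) (hgn : g.natDegree = n)
    (h : ∀ i : Fin n, φ (a i) = g.coeff i) : (intPoly n a).map φ = g := by
  rw [ext_iff_natDegree_le (intPoly_map_natDegree φ a).le hgn.le]
  intro i hi
  rcases hi.lt_or_eq with hi | rfl
  · rw [coeff_map, intPoly_coeff a ⟨i, hi⟩, h ⟨i, hi⟩]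
  · have h1 := (intPoly_map_monic φ a).coeff_natDegree
    have h2 := hg.coeff_natDegree
    rw [intPoly_map_natDegree] at h1
    rw [hgn] at h2
    rw [h1, h2]

end IntPoly

section IrreducibleFactors

variable {K : Type*} [Field K]

/-- The monic irreducible factors of a nonzero polynomial. -/
def monicFactors (g : K[X]) : Finset K[X] :=
  (UniqueFactorizationMonoid.normalizedFactors g).toFinset

lemma mem_monicFactors {g h : K[X]} (hg : g ≠ 0) :
    h ∈ monicFactors g ↔ h.Monic ∧ Irreducible h ∧ h ∣ g := by
  rw [monicFactors, Multiset.mem_toFinset, Polynomial.mem_normalizedFactors_iff hg]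
  tauto

lemma prod_monicFactors {g : K[X]} (hg : g.Monic) (hsq : Squarefree g) :
    ∏ h ∈ monicFactors g, h = g := by
  have h1 := UniqueFactorizationMonoid.prod_normalizedFactors hg.ne_zero
  have h2 := (UniqueFactorizationMonoid.squarefree_iff_nodup_normalizedFactors hg.ne_zero).1 hsq
  have h3 := monic_multiset_prod_of_monic (UniqueFactorizationMonoid.normalizedFactors g)
    (fun h : K[X] => h) fun h hh => ((Polynomial.mem_normalizedFactors_iff hg.ne_zero).1 hh).2.1
  rw [Multiset.map_id'] at h3
  rw [Finset.prod, monicFactors, Multiset.toFinset_val, h2.dedup, Multiset.map_id']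
  exact eq_of_monic_of_associated h3 hg h1

lemma squarefree_prod_of_monic_irreducible {s : Finset K[X]}
    (hs : ∀ h ∈ s, h.Monic ∧ Irreducible h) : Squarefree (∏ h ∈ s, h) := by
  refine Finset.squarefree_prod_of_pairwise_isCoprime (fun f hf g hg hfg => ?_)
    fun h hh => (hs h hh).2.squarefree
  refine (hs f hf).2.isRelPrime_iff_not_dvd.2 fun hdvd => hfg ?_
  exact eq_of_monic_of_associated (hs f hf).1 (hs g hg).1
    ((hs f hf).2.associated_of_dvd (hs g hg).2 hdvd)

lemma monicFactors_prod {s : Finset K[X]}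
    (hs : ∀ h ∈ s, h.Monic ∧ Irreducible h) : monicFactors (∏ h ∈ s, h) = s := by
  have hm : (∏ h ∈ s, h).Monic := monic_prod_of_monic _ _ fun h hh => (hs h hh).1
  ext h
  rw [mem_monicFactors hm.ne_zero]
  refine ⟨fun ⟨h1, h2, h3⟩ => ?_, fun hh => ⟨(hs h hh).1, (hs h hh).2, dvd_prod_of_mem _ hh⟩⟩
  obtain ⟨g, hg, hdvd⟩ := (h2.prime.dvd_finsetProd_iff _).1 h3
  rwa [eq_of_monic_of_associated h1 (hs g hg).1 (h2.associated_of_dvd (hs g hg).2 hdvd)]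

end IrreducibleFactors

section CountIrreducible

variable {p : ℕ} [hp : Fact p.Prime]

/-- The monic irreducible polynomials of degree `d` over `𝔽_p`. -/
def monicIrred (p : ℕ) [Fact p.Prime] (d : ℕ) : Finset (ZMod p)[X] :=
  (monicFactors (X ^ p ^ d - X : (ZMod p)[X])).filter fun h => h.natDegree = d

lemma X_pow_sub_X_monic {d : ℕ} (hd : d ≠ 0) : (X ^ p ^ d - X : (ZMod p)[X]).Monic :=
  monic_X_pow_sub (by
    rw [degree_X]; exact_mod_cast Nat.one_lt_pow hd hp.out.one_lt)

lemma X_pow_sub_X_natDegree {d : ℕ} (hd : d ≠ 0) :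
    (X ^ p ^ d - X : (ZMod p)[X]).natDegree = p ^ d :=
  FiniteField.X_pow_card_pow_sub_X_natDegree_eq _ hd hp.out.one_lt

lemma mem_monicFactors_X_pow_sub_X {d : ℕ} (hd : d ≠ 0) {h : (ZMod p)[X]} :
    h ∈ monicFactors (X ^ p ^ d - X : (ZMod p)[X]) ↔
      h.Monic ∧ Irreducible h ∧ h.natDegree ∣ d := by
  rw [mem_monicFactors (X_pow_sub_X_monic hd).ne_zero]
  refine and_congr_right fun _ => and_congr_right fun hi => ?_
  have := hi.natDegree_dvd_iff_dvd_X_pow_card_pow_sub_X (n := d)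
  rw [Nat.card_zmod] at this
  exact this.symm

lemma mem_monicIrred {d : ℕ} (hd : d ≠ 0) {h : (ZMod p)[X]} :
    h ∈ monicIrred p d ↔ h.Monic ∧ Irreducible h ∧ h.natDegree = d := by
  rw [monicIrred, mem_filter, mem_monicFactors_X_pow_sub_X hd]
  constructor
  · rintro ⟨⟨h1, h2, -⟩, h3⟩
    exact ⟨h1, h2, h3⟩
  · rintro ⟨h1, h2, h3⟩
    exact ⟨⟨h1, h2, h3.dvd⟩, h3⟩

lemma sum_divisors_mul_card_monicIrred {d : ℕ} (hd : d ≠ 0) :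
    ∑ e ∈ d.divisors, e * #(monicIrred p e) = p ^ d := by
  have hsep : (X ^ p ^ d - X : (ZMod p)[X]).Separable :=
    galois_poly_separable p _ (dvd_pow_self p hd)
  have h1 := prod_monicFactors (X_pow_sub_X_monic hd) hsep.squarefree
  have h2 := congrArg natDegree h1
  rw [natDegree_prod_of_monic _ _ fun h hh => ((mem_monicFactors_X_pow_sub_X hd).1 hh).1,
    X_pow_sub_X_natDegree hd, ← sum_fiberwise_of_maps_to (t := d.divisors) (g := natDegree)
      fun h hh => Nat.mem_divisors.2 ⟨((mem_monicFactors_X_pow_sub_X hd).1 hh).2.2, hd⟩] at h2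
  rw [← h2]
  refine sum_congr rfl fun e he => ?_
  have he0 : e ≠ 0 := (Nat.pos_of_mem_divisors he).ne'
  have : (monicFactors (X ^ p ^ d - X : (ZMod p)[X])).filter (fun h => h.natDegree = e)
      = monicIrred p e := by
    ext h
    rw [mem_filter, mem_monicFactors_X_pow_sub_X hd, mem_monicIrred he0]
    have := Nat.dvd_of_mem_divisors he
    constructor
    · rintro ⟨⟨h1, h2, -⟩, h3⟩
      exact ⟨h1, h2, h3⟩
    · rintro ⟨h1, h2, h3⟩
      exact ⟨⟨h1, h2, h3 ▸ this⟩, h3⟩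
  rw [this, sum_congr rfl fun h hh => ((mem_monicIrred he0).1 hh).2.2, sum_const, smul_eq_mul,
    mul_comm]

lemma mul_card_monicIrred_le {d : ℕ} (hd : d ≠ 0) : d * #(monicIrred p d) ≤ p ^ d := by
  rw [← sum_divisors_mul_card_monicIrred hd]
  exact single_le_sum (f := fun e => e * #(monicIrred p e)) (fun _ _ => Nat.zero_le _)
    (Nat.mem_divisors_self d hd)

lemma pow_le_mul_card_monicIrred_add {d : ℕ} (hd : d ≠ 0) :
    p ^ d ≤ d * #(monicIrred p d) + d * p ^ (d - 1) := by
  rw [← sum_divisors_mul_card_monicIrred hd, ← Nat.cons_self_properDivisors hd, sum_cons]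
  gcongr
  calc ∑ e ∈ d.properDivisors, e * #(monicIrred p e)
      ≤ ∑ e ∈ d.properDivisors, p ^ (d - 1) := by
        refine sum_le_sum fun e he => ?_
        have he' := Nat.mem_properDivisors.1 he
        have he0 : e ≠ 0 := (Nat.pos_of_mem_properDivisors he).ne'
        exact (mul_card_monicIrred_le he0).trans
          (Nat.pow_le_pow_right hp.out.pos (by omega))
    _ ≤ d * p ^ (d - 1) := by
        rw [sum_const, smul_eq_mul]
        gcongr
        exact (card_filter_le _ _).trans (by simp)

end CountIrreducible

section CountSplit

variable {n : ℕ} {p : ℕ} [hp : Fact p.Prime]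

lemma splitTypeOf_iff {r : Fin n → ℕ} {g : (ZMod p)[X]} :
    SplitTypeOf g r ↔ Squarefree g ∧
      ∀ i : Fin n, #((monicIrred p (i + 1)).filter (· ∣ g)) = r i := by
  refine and_congr_right fun _ => forall_congr' fun i => ?_
  have : Nat.card {h : (ZMod p)[X] // h.Monic ∧ Irreducible h ∧ h.natDegree = (i : ℕ) + 1 ∧ h ∣ g}
      = #((monicIrred p (i + 1)).filter (· ∣ g)) := by
    refine Nat.subtype_card _ fun h => ?_
    rw [mem_filter, mem_monicIrred (Nat.succ_ne_zero _)]
    tauto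
  rw [this]

lemma prod_prod_filter_monicIrred {g : (ZMod p)[X]} (hg : g.Monic) (hsq : Squarefree g)
    (hgn : g.natDegree = n) :
    ∏ i : Fin n, ∏ h ∈ (monicIrred p (i + 1)).filter (· ∣ g), h = g := by
  conv_rhs => rw [← prod_monicFactors hg hsq]
  have hfib : ∀ i : Fin n, (monicIrred p (i + 1)).filter (· ∣ g)
      = (monicFactors g).filter fun h => h.natDegree = (i : ℕ) + 1 := by
    intro i
    ext h
    rw [mem_filter, mem_filter, mem_monicIrred (Nat.succ_ne_zero _), mem_monicFactors hg.ne_zero]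
    tauto
  simp_rw [hfib]
  rw [Fin.prod_univ_eq_prod_range
    (fun i => ∏ h ∈ (monicFactors g).filter (fun h => h.natDegree = i + 1), h) n,
    ← prod_fiberwise_of_maps_to (t := range n) (s := monicFactors g)
      (g := fun h : (ZMod p)[X] => h.natDegree - 1)]
  · refine prod_congr rfl fun i _ => prod_congr ?_ fun _ _ => rfl
    refine filter_congr fun h hh => ?_
    have := ((mem_monicFactors hg.ne_zero).1 hh).2.1.natDegree_pos
    omega
  · intro h hh
    obtain ⟨h1, h2, h3⟩ := (mem_monicFactors hg.ne_zero).1 hh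
    have := h2.natDegree_pos
    have := natDegree_le_of_dvd h3 hg.ne_zero
    rw [mem_range]
    omega

lemma card_residues_hasSplitType {r : Fin n → ℕ} (hr : ∑ i : Fin n, ((i : ℕ) + 1) * r i = n) :
    #((Fintype.piFinset fun _ : Fin n => range p).filter
        fun c => HasSplitType n r (fun i => (c i : ℤ)) p) =
      ∏ i : Fin n, (#(monicIrred p (i + 1))).choose (r i) := by
  simp_rw [← card_powersetCard]
  rw [← Fintype.card_piFinset]
  set P : (Fin n → ℕ) → (ZMod p)[X] := fun c =>
    (intPoly n fun i => (c i : ℤ)).map (Int.castRingHom (ZMod p)) with hP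
  have hPm : ∀ c, (P c).Monic := fun c => intPoly_map_monic _ _
  have hPn : ∀ c, (P c).natDegree = n := fun c => intPoly_map_natDegree _ _
  set Q : (Fin n → Finset (ZMod p)[X]) → (ZMod p)[X] := fun s => ∏ i, ∏ h ∈ s i, h with hQ
  have hmemQ : ∀ s ∈ Fintype.piFinset fun i : Fin n => powersetCard (r i) (monicIrred p (i + 1)),
      ∀ i, ∀ h ∈ s i, h.Monic ∧ Irreducible h ∧ h.natDegree = (i : ℕ) + 1 := by
    intro s hs i h hh
    have := (mem_powersetCard.1 (Fintype.mem_piFinset.1 hs i)).1 hh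
    exact (mem_monicIrred (Nat.succ_ne_zero _)).1 this
  have hQm : ∀ s ∈ Fintype.piFinset fun i : Fin n => powersetCard (r i) (monicIrred p (i + 1)),
      (Q s).Monic := fun s hs =>
    monic_prod_of_monic _ _ fun i _ => monic_prod_of_monic _ _ fun h hh => (hmemQ s hs i h hh).1
  have hQn : ∀ s ∈ Fintype.piFinset fun i : Fin n => powersetCard (r i) (monicIrred p (i + 1)),
      (Q s).natDegree = n := by
    intro s hs
    rw [hQ, natDegree_prod_of_monic _ _ fun i _ =>
      monic_prod_of_monic _ _ fun h hh => (hmemQ s hs i h hh).1]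
    conv_rhs => rw [← hr]
    refine sum_congr rfl fun i _ => ?_
    rw [natDegree_prod_of_monic _ _ fun h hh => (hmemQ s hs i h hh).1,
      sum_congr rfl fun h hh => (hmemQ s hs i h hh).2.2, sum_const,
      (mem_powersetCard.1 (Fintype.mem_piFinset.1 hs i)).2, smul_eq_mul, mul_comm]
  have hQU : ∀ s ∈ Fintype.piFinset fun i : Fin n => powersetCard (r i) (monicIrred p (i + 1)),
      Q s = ∏ h ∈ univ.biUnion s, h := by
    intro s hs
    rw [prod_biUnion]
    intro i _ j _ hij
    refine Finset.disjoint_left.2 fun h hi hj => hij (Fin.ext ?_)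
    have h1 := (hmemQ s hs i h hi).2.2
    have h2 := (hmemQ s hs j h hj).2.2
    omega
  have hU : ∀ s ∈ Fintype.piFinset fun i : Fin n => powersetCard (r i) (monicIrred p (i + 1)),
      ∀ h ∈ univ.biUnion s, h.Monic ∧ Irreducible h := by
    intro s hs h hh
    obtain ⟨i, -, hi⟩ := mem_biUnion.1 hh
    exact ⟨(hmemQ s hs i h hi).1, (hmemQ s hs i h hi).2.1⟩
  have hfilt : ∀ s ∈ Fintype.piFinset fun i : Fin n => powersetCard (r i) (monicIrred p (i + 1)),
      ∀ i : Fin n, (monicIrred p (i + 1)).filter (· ∣ Q s) = s i := by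
    intro s hs i
    ext h
    have key : h ∈ monicFactors (Q s) ↔ h ∈ univ.biUnion s := by
      rw [hQU s hs, monicFactors_prod (hU s hs)]
    rw [mem_monicFactors (hQm s hs).ne_zero, mem_biUnion] at key
    rw [mem_filter, mem_monicIrred (Nat.succ_ne_zero _)]
    constructor
    · rintro ⟨⟨h1, h2, h3⟩, h4⟩
      obtain ⟨j, -, hj⟩ := key.1 ⟨h1, h2, h4⟩
      have := (hmemQ s hs j h hj).2.2
      rwa [show i = j from Fin.ext (by omega)]
    · intro hi
      exact ⟨hmemQ s hs i h hi, (key.2 ⟨i, mem_univ _, hi⟩).2.2⟩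
  have hPQ : ∀ s ∈ Fintype.piFinset fun i : Fin n => powersetCard (r i) (monicIrred p (i + 1)),
      P (fun i => ((Q s).coeff i).val) = Q s := by
    intro s hs
    refine intPoly_map_eq_of_coeff _ (hQm s hs) (hQn s hs) fun i => ?_
    simp
  refine card_nbij' (fun c i => (monicIrred p (i + 1)).filter (· ∣ P c))
    (fun s i => ((Q s).coeff i).val) ?_ ?_ ?_ ?_
  · intro c hc
    rw [mem_coe, mem_filter] at hc
    have := splitTypeOf_iff.1 hc.2
    rw [mem_coe, Fintype.mem_piFinset]
    exact fun i => mem_powersetCard.2 ⟨filter_subset _ _, this.2 i⟩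
  · intro s hs
    rw [mem_coe] at hs
    rw [mem_coe, mem_filter, Fintype.mem_piFinset]
    refine ⟨fun i => mem_range.2 (ZMod.val_lt _), ?_⟩
    change SplitTypeOf (P fun i => ((Q s).coeff i).val) r
    rw [hPQ s hs, splitTypeOf_iff]
    refine ⟨?_, fun i => ?_⟩
    · rw [hQU s hs]
      exact squarefree_prod_of_monic_irreducible (hU s hs)
    · rw [hfilt s hs i]
      exact (mem_powersetCard.1 (Fintype.mem_piFinset.1 hs i)).2
  · intro c hc
    rw [mem_coe, mem_filter, Fintype.mem_piFinset] at hc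
    have hsq := (splitTypeOf_iff.1 hc.2).1
    have := prod_prod_filter_monicIrred (hPm c) hsq (hPn c)
    funext i
    simp only [hQ]
    rw [this, hP, coeff_map, intPoly_coeff]
    simp [ZMod.val_natCast_of_lt (mem_range.1 (hc.1 i))]
  · intro s hs
    rw [mem_coe] at hs
    funext i
    simp only
    rw [hPQ s hs, hfilt s hs i]

end CountSplit

section PrimeLimit

/-- `f p = c + O(1/p)` as `p` runs over the primes. -/
def PrimeLimit (f : Nat.Primes → ℝ) (c : ℝ) : Prop :=
  ∃ A, 0 ≤ A ∧ ∀ p : Nat.Primes, |f p - c| ≤ A * (1 / ((p : ℕ) : ℝ))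

lemma primeLimit_const (c : ℝ) : PrimeLimit (fun _ => c) c :=
  ⟨0, le_rfl, fun _ => by simp⟩

lemma PrimeLimit.mul {f g : Nat.Primes → ℝ} {c d : ℝ} (hf : PrimeLimit f c)
    (hg : PrimeLimit g d) : PrimeLimit (fun p => f p * g p) (c * d) := by
  obtain ⟨A, hA, hf⟩ := hf
  obtain ⟨B, hB, hg⟩ := hg
  refine ⟨A * B + A * |d| + |c| * B, by positivity, fun p => ?_⟩
  have hp : (1 : ℝ) ≤ (p : ℕ) := by exact_mod_cast p.2.one_lt.le
  set t : ℝ := 1 / ((p : ℕ) : ℝ) with ht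
  have ht0 : 0 ≤ t := by positivity
  have ht1 : t ≤ 1 := by rw [ht, div_le_one (by linarith)]; exact hp
  have e : f p * g p - c * d = (f p - c) * (g p - d) + (f p - c) * d + c * (g p - d) := by ring
  rw [e]
  refine (abs_add_three _ _ _).trans ?_
  rw [abs_mul, abs_mul, abs_mul]
  have h1 : |f p - c| * |g p - d| ≤ (A * t) * (B * t) := by
    gcongr
    exacts [hf p, hg p]
  have h2 : |f p - c| * |d| ≤ A * t * |d| := by gcongr; exact hf p
  have h3 : |c| * |g p - d| ≤ |c| * (B * t) := by gcongr; exact hg p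
  have h4 : (A * t) * (B * t) ≤ A * B * t := by
    have : A * B * t * t ≤ A * B * t * 1 := by gcongr
    nlinarith
  nlinarith

lemma PrimeLimit.prod {ι : Type*} (s : Finset ι) {f : ι → Nat.Primes → ℝ} {c : ι → ℝ}
    (hf : ∀ i ∈ s, PrimeLimit (f i) (c i)) :
    PrimeLimit (fun p => ∏ i ∈ s, f i p) (∏ i ∈ s, c i) := by
  induction s using Finset.induction_on with
  | empty => simpa using primeLimit_const 1
  | insert i s hi ih =>
    simp only [prod_insert hi]
    exact (hf i (mem_insert_self _ _)).mul (ih fun j hj => hf j (mem_insert_of_mem hj))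

end PrimeLimit

section Density

variable {n : ℕ}

lemma primeLimit_card_monicIrred_sub (d j : ℕ) (hd : d ≠ 0) :
    PrimeLimit (fun p => haveI := Fact.mk p.2
      ((#(monicIrred p d) - j : ℕ) : ℝ) / ((p : ℕ) : ℝ) ^ d) (1 / d) := by
  refine ⟨1 + j, by positivity, fun p => ?_⟩
  have := Fact.mk p.2
  set M := #(monicIrred (p : ℕ) d) with hM
  set P : ℝ := ((p : ℕ) : ℝ) with hP
  have hP1 : 1 ≤ P := by
    rw [hP]; exact_mod_cast p.2.one_lt.le
  have hd0 : (1 : ℝ) ≤ d := by exact_mod_cast Nat.one_le_iff_ne_zero.2 hd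
  have h1 : (d : ℝ) * M ≤ P ^ d := by
    rw [hP, hM]; exact_mod_cast mul_card_monicIrred_le (p := p) hd
  have h2 : P ^ d ≤ d * M + d * P ^ (d - 1) := by
    rw [hP, hM]; exact_mod_cast pow_le_mul_card_monicIrred_add (p := p) hd
  have h3 : ((M - j : ℕ) : ℝ) ≤ M := by exact_mod_cast Nat.sub_le _ _
  have h4 : (M : ℝ) ≤ (M - j : ℕ) + j := by exact_mod_cast Nat.sub_le_iff_le_add.1 le_rfl
  have h5 : P ^ d = P ^ (d - 1) * P := by rw [← pow_succ, Nat.sub_add_cancel (by omega)]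
  have h6 : 1 ≤ P ^ (d - 1) := one_le_pow₀ hP1
  have hPd : 0 < P ^ d := by positivity
  have e : (M - j : ℕ) / P ^ d - 1 / d = (d * (M - j : ℕ) - P ^ d) / (d * P ^ d) := by
    field_simp
  change |((M - j : ℕ) : ℝ) / P ^ d - 1 / d| ≤ (1 + j) * (1 / P)
  have e2 : (1 + (j : ℝ)) * (1 / P) = (d * ((1 + j) * P ^ (d - 1))) / (d * P ^ d) := by
    rw [h5]; field_simp
  rw [e, e2, abs_div, abs_of_pos (by positivity : 0 < d * P ^ d)]
  gcongr
  rw [abs_le]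
  have h7 : (j : ℝ) ≤ j * P ^ (d - 1) := le_mul_of_one_le_right (by positivity) h6
  constructor <;> nlinarith [mul_nonneg (by positivity : (0:ℝ) ≤ d) (sub_nonneg.2 h7),
    mul_nonneg (by positivity : (0:ℝ) ≤ d) (sub_nonneg.2 h3),
    mul_nonneg (by positivity : (0:ℝ) ≤ d) (sub_nonneg.2 h4),
    (by positivity : 0 ≤ (d : ℝ) * ((1 + j) * P ^ (d - 1)))]

lemma primeLimit_choose_card_monicIrred (d m : ℕ) (hd : d ≠ 0) :
    PrimeLimit (fun p => haveI := Fact.mk p.2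
      ((#(monicIrred p d)).choose m : ℝ) / ((p : ℕ) : ℝ) ^ (d * m))
      (1 / ((d ^ m * m.factorial : ℕ) : ℝ)) := by
  have h := (PrimeLimit.prod (range m) fun j _ => primeLimit_card_monicIrred_sub d j hd).mul
    (primeLimit_const (1 / (m.factorial : ℝ)))
  convert h using 1
  · funext p
    have := Fact.mk p.2
    rw [prod_div_distrib, ← Nat.cast_prod, ← Nat.descFactorial_eq_prod_range,
      Nat.descFactorial_eq_factorial_mul_choose, prod_const, card_range, ← pow_mul]
    have := m.factorial_ne_zero
    push_cast
    field_simp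
  · simp [mul_comm]

/-- The indicator function of the vectors with splitting type `r` modulo `p`. -/
def splitInd (r : Fin n → ℕ) (p : ℕ) (a : Fin n → ℤ) : ℝ :=
  if HasSplitType n r a p then 1 else 0

lemma periodicMod_splitInd (r : Fin n → ℕ) (p : ℕ) : PeriodicMod p (splitInd r p) := by
  intro a b hab
  have : (intPoly n a).map (Int.castRingHom (ZMod p)) =
      (intPoly n b).map (Int.castRingHom (ZMod p)) := by
    rw [intPoly_map, intPoly_map]
    congr 1
    refine sum_congr rfl fun i _ => ?_
    congr 2
    exact (ZMod.intCast_eq_intCast_iff _ _ _).2 (hab i)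
  have h : HasSplitType n r a p ↔ HasSplitType n r b p := by rw [HasSplitType, HasSplitType, this]
  simp only [splitInd, h]

/-- Polynomials with splitting type `r` modulo `p` have density `δ(r) + O(1/p)`. -/
lemma exists_abs_residueMean_splitInd_sub_le {r : Fin n → ℕ}
    (hr : ∑ i : Fin n, ((i : ℕ) + 1) * r i = n) :
    ∃ A, 0 ≤ A ∧ ∀ p : ℕ, p.Prime →
      |residueMean p (splitInd r p) - splitDelta n r| ≤ A * (1 / (p : ℝ)) := by
  obtain ⟨A, hA, h⟩ := PrimeLimit.prod (univ : Finset (Fin n)) fun i _ =>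
    primeLimit_choose_card_monicIrred ((i : ℕ) + 1) (r i) (Nat.succ_ne_zero _)
  refine ⟨A, hA, fun p hp => ?_⟩
  have := Fact.mk hp
  have key : residueMean p (splitInd r p) = ∏ i : Fin n,
      ((#(monicIrred p ((i : ℕ) + 1))).choose (r i) : ℝ) / (p : ℝ) ^ (((i : ℕ) + 1) * r i) := by
    rw [prod_div_distrib, prod_pow_eq_pow_sum, hr, residueMean]
    congr 1
    simp only [splitInd]
    rw [sum_boole, card_residues_hasSplitType hr]
    push_cast
    rfl
  rw [key]
  exact h ⟨p, hp⟩

lemma splitDelta_pos (r : Fin n → ℕ) : 0 < splitDelta n r :=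
  prod_pos fun i _ => by positivity

lemma splitDelta_lt_one (hn : 2 ≤ n) {r : Fin n → ℕ}
    (hr : ∑ i : Fin n, ((i : ℕ) + 1) * r i = n) : splitDelta n r < 1 := by
  have hle : ∀ i ∈ (univ : Finset (Fin n)),
      (1 : ℝ) / ((((i : ℕ) + 1) ^ (r i) * Nat.factorial (r i) : ℕ) : ℝ) ≤ 1 := by
    intro i _
    rw [div_le_one (by positivity)]
    exact_mod_cast Nat.one_le_iff_ne_zero.2 (by positivity)
  have key : ∃ i : Fin n, 1 < ((i : ℕ) + 1) ^ (r i) * Nat.factorial (r i) := by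
    by_contra! hcon
    have h1 : ∀ i : Fin n, ((i : ℕ) + 1) * r i ≤ 1 := by
      intro i
      have h2 := hcon i
      have h3 : 1 ≤ Nat.factorial (r i) := Nat.factorial_pos _
      have h4 : 1 ≤ ((i : ℕ) + 1) ^ r i := Nat.one_le_pow _ _ (by omega)
      have h5 : Nat.factorial (r i) ≤ 1 := by nlinarith
      have h6 : ((i : ℕ) + 1) ^ r i ≤ 1 := by nlinarith
      have h7 : r i ≤ 1 := (Nat.self_le_factorial _).trans h5
      rcases Nat.le_one_iff_eq_zero_or_eq_one.1 h7 with h | h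
      · simp [h]
      · rw [h, pow_one] at h6
        rw [h]; omega
    have h0 : ∀ i : Fin n, (i : ℕ) ≠ 0 → ((i : ℕ) + 1) * r i = 0 := by
      intro i hi
      have := h1 i
      rcases Nat.eq_zero_or_pos (r i) with h | h
      · simp [h]
      · nlinarith [Nat.pos_of_ne_zero hi]
    rw [sum_eq_single (⟨0, by omega⟩ : Fin n)
      (fun i _ hi => h0 i fun h => hi (Fin.ext h)) (by simp)] at hr
    have := h1 ⟨0, by omega⟩
    omega
  obtain ⟨i, hi⟩ := key
  rw [splitDelta, ← mul_prod_erase _ _ (mem_univ i)]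
  have h1 : ∏ j ∈ univ.erase i, (1 : ℝ) / ((((j : ℕ) + 1) ^ (r j) * Nat.factorial (r j) : ℕ) : ℝ)
      ≤ 1 := prod_le_one (fun j _ => by positivity) fun j hj => hle j (mem_univ j)
  refine lt_of_le_of_lt (mul_le_of_le_one_right (by positivity) h1) ?_
  rw [div_lt_one (by positivity)]
  exact_mod_cast hi

end Density

/-- The primes up to `y`. -/
def primesTo (y : ℕ) : Finset ℕ :=
  (range (y + 1)).filter Nat.Prime

lemma prime_of_mem_primesTo {y p : ℕ} (hp : p ∈ primesTo y) : p.Prime :=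
  (mem_filter.1 hp).2

lemma le_of_mem_primesTo {y p : ℕ} (hp : p ∈ primesTo y) : p ≤ y :=
  Nat.lt_succ_iff.1 (mem_range.1 (mem_filter.1 hp).1)

lemma card_primesTo (y : ℕ) : #(primesTo y) = Nat.primeCounting y := by
  rw [primesTo, Nat.primeCounting, Nat.primeCounting', Nat.count_eq_card_filter_range]

lemma card_primesTo_le (y : ℕ) : #(primesTo y) ≤ y := by
  have h : primesTo y ⊆ Icc 1 y := fun p hp =>
    mem_Icc.2 ⟨(prime_of_mem_primesTo hp).one_le, le_of_mem_primesTo hp⟩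
  simpa using card_le_card h

lemma sum_one_div_primesTo_le (y : ℕ) : ∑ p ∈ primesTo y, 1 / (p : ℝ) ≤ 1 + Real.log y := by
  have h : primesTo y ⊆ Icc 1 y := fun p hp =>
    mem_Icc.2 ⟨(prime_of_mem_primesTo hp).one_le, le_of_mem_primesTo hp⟩
  have h1 := harmonic_le_one_add_log y
  rw [harmonic_eq_sum_Icc] at h1
  push_cast at h1
  refine le_trans ?_ h1
  simp only [one_div]
  exact sum_le_sum_of_subset_of_nonneg h fun _ _ _ => by positivity

lemma eventually_rpow_le_card_primesTo :
    ∀ᶠ x : ℝ in atTop, x ^ (3 / 4 : ℝ) ≤ #(primesTo ⌊x⌋₊) := by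
  have h1 := (isLittleO_log_rpow_atTop (r := 1 / 4) (by norm_num)).bound
    (c := 1 / 4) (by norm_num)
  filter_upwards [h1, eventually_ge_atTop (16 : ℝ)] with x h1 hx
  have hx0 : 0 < x := by linarith
  have hlog : 0 < Real.log x := Real.log_pos (by linarith)
  rw [Real.norm_of_nonneg hlog.le, Real.norm_of_nonneg (by positivity)] at h1
  rw [card_primesTo]
  refine le_trans ?_ (Chebyshev.pi_ge' (by linarith : 1 < x))
  rw [le_div_iff₀ hlog]
  have h2 : x ^ (3 / 4 : ℝ) * x ^ (1 / 4 : ℝ) = x := by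
    rw [← Real.rpow_add hx0]; norm_num
  have h3 : x ^ (3 / 4 : ℝ) * Real.log x ≤ x / 4 := by
    calc _ ≤ x ^ (3 / 4 : ℝ) * (1 / 4 * x ^ (1 / 4 : ℝ)) := by gcongr
      _ = x / 4 := by linear_combination h2 / 4
  have h4 := Real.log_two_gt_d9
  have h5 : Real.log (x + 2) ≤ Real.log 2 + Real.log x := by
    rw [← Real.log_mul (by norm_num) hx0.ne']
    exact Real.log_le_log (by linarith) (by linarith)
  have h6 : x ^ (1 / 4 : ℝ) ≤ x / 8 := by
    have h7 : (8 : ℝ) ≤ x ^ (3 / 4 : ℝ) := by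
      calc (8 : ℝ) = (16 : ℝ) ^ (3 / 4 : ℝ) := by
            rw [show (16 : ℝ) = 2 ^ (4 : ℝ) by norm_num, ← Real.rpow_mul (by norm_num)]
            norm_num
        _ ≤ _ := by gcongr
    nlinarith [Real.rpow_nonneg hx0.le (1 / 4)]
  nlinarith [Real.log_two_lt_d9]

section Deviation

variable {n : ℕ}

/-- The deviation of the indicator of splitting type `r` modulo `p` from its mean `δ(r)`. -/
def splitDev (r : Fin n → ℕ) (p : ℕ) (a : Fin n → ℤ) : ℝ :=
  splitInd r p a - splitDelta n r

lemma periodicMod_splitDev (r : Fin n → ℕ) (p : ℕ) : PeriodicMod p (splitDev r p) :=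
  fun a b h => by rw [splitDev, splitDev, periodicMod_splitInd r p a b h]

lemma abs_splitDev_le_one (hn : 2 ≤ n) {r : Fin n → ℕ}
    (hr : ∑ i : Fin n, ((i : ℕ) + 1) * r i = n) (p : ℕ) (a : Fin n → ℤ) :
    |splitDev r p a| ≤ 1 := by
  have h1 := splitDelta_pos r
  have h2 := splitDelta_lt_one hn hr
  rw [splitDev, splitInd, abs_le]
  split_ifs <;> constructor <;> linarith

/-- Growth of the moments of `∑ p ≤ y, splitDev r p` over residues, and the asymptotics of
the even ones. -/
lemma exists_residueMean_moment_le (hn : 2 ≤ n) {r : Fin n → ℕ}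
    (hr : ∑ i : Fin n, ((i : ℕ) + 1) * r i = n) :
    ∃ A, 0 ≤ A ∧ ∀ (y k : ℕ) (D G : ℝ), D = k * A * ∑ p ∈ primesTo y, 1 / (p : ℝ) + 2 ^ k →
      G = 2 ^ k * (2 * A * D ^ k * ∑ p ∈ primesTo y, 1 / (p : ℝ) + 1 + D ^ k +
        Nat.factorial k) →
      |residueMean (∏ p ∈ primesTo y, p) (fun a => (∑ p ∈ primesTo y, splitDev r p a) ^ k)| ≤
        D ^ k * (#(primesTo y) : ℝ) ^ (k / 2) ∧
      ∀ m, 2 * m = k → #(primesTo y) *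
        |residueMean (∏ p ∈ primesTo y, p) (fun a => (∑ p ∈ primesTo y, splitDev r p a) ^ k) -
          gaussMoment (splitDelta n r - splitDelta n r ^ 2) m * (#(primesTo y) : ℝ) ^ m| ≤
        G ^ m * (#(primesTo y) : ℝ) ^ m := by
  obtain ⟨A, hA, h⟩ := exists_abs_residueMean_splitInd_sub_le hr
  have hδ := splitDelta_pos r
  have hδ1 := splitDelta_lt_one hn hr
  refine ⟨A, hA, fun y k D G hD hG => ?_⟩
  have hS₀ : ∀ p ∈ primesTo y, p.Prime := fun p hp => prime_of_mem_primesTo hp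
  have hlin : ∀ p ∈ primesTo y, ∀ c d : ℝ, residueMean p (fun a => splitInd r p a * c + d) =
      residueMean p (splitInd r p) * c + d := by
    intro p hp c d
    have h0 := (hS₀ p hp).ne_zero
    have h1 := residueMean_const (n := n) h0 d
    rw [← h1, ← residueMean_mul_const, h1, residueMean, residueMean, sum_add_distrib, add_div]
    congr 1
  let M : Finset ℕ → ℕ → ℝ := fun S j =>
    residueMean (∏ p ∈ S, p) fun a => (∑ p ∈ S, splitDev r p a) ^ j
  let μ : ℕ → ℕ → ℝ := fun p j => residueMean p fun a => splitDev r p a ^ j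
  have hM0 : ∀ S ⊆ primesTo y, M S 0 = 1 := fun S hS => by
    simpa [M] using residueMean_const (n := n) (prod_primes_ne_zero hS₀ hS) 1
  have hMempty : ∀ j, j ≠ 0 → M ∅ j = 0 := fun j hj => by
    simp [M, residueMean, hj]
  have hrec : ∀ S p, p ∉ S → insert p S ⊆ primesTo y → ∀ j, M (insert p S) j =
      ∑ i ∈ range (j + 1), M S i * μ p (j - i) * (j.choose i : ℝ) := fun S p hp hS j =>
    residueMean_moment_insert hS₀ (fun p _ => periodicMod_splitDev r p) hp hS j
  have hμ0 : ∀ p ∈ primesTo y, μ p 0 = 1 := fun p hp => by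
    simpa [μ] using residueMean_const (n := n) (hS₀ p hp).ne_zero 1
  have hμ : ∀ p ∈ primesTo y, ∀ i, |μ p i| ≤ 1 := fun p hp i =>
    abs_residueMean_le (hS₀ p hp).ne_zero fun a => by
      rw [abs_pow]
      exact pow_le_one₀ (abs_nonneg _) (abs_splitDev_le_one hn hr p a)
  have hμ1 : ∀ p ∈ primesTo y, |μ p 1| ≤ A * (1 / (p : ℝ)) := fun p hp => by
    have h1 := hlin p hp 1 (-splitDelta n r)
    have h2 : μ p 1 = residueMean p (splitInd r p) - splitDelta n r := by
      rw [mul_one, ← sub_eq_add_neg] at h1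
      rw [← h1]
      simp [μ, splitDev, sub_eq_add_neg]
    rw [h2]
    exact h p (hS₀ p hp)
  have hμ2 : ∀ p ∈ primesTo y, |μ p 2 - (splitDelta n r - splitDelta n r ^ 2)| ≤
      A * (1 / (p : ℝ)) := fun p hp => by
    have h1 := hlin p hp (1 - 2 * splitDelta n r) (splitDelta n r ^ 2)
    have h2 : μ p 2 = residueMean p (splitInd r p) * (1 - 2 * splitDelta n r) +
        splitDelta n r ^ 2 := by
      rw [← h1]
      simp only [μ]
      congr 1
      funext a
      rw [splitDev, splitInd]
      split_ifs <;> ring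
    have h3 : μ p 2 - (splitDelta n r - splitDelta n r ^ 2) =
        (residueMean p (splitInd r p) - splitDelta n r) * (1 - 2 * splitDelta n r) := by
      rw [h2]; ring
    rw [h3, abs_mul]
    exact (mul_le_of_le_one_right (abs_nonneg _)
      (abs_le.2 ⟨by linarith, by linarith⟩)).trans (h p (hS₀ p hp))
  refine ⟨momentRec_abs_le hA hM0 hMempty hrec hμ0 hμ hμ1 hD k le_rfl _ (Subset.refl _), ?_⟩
  rintro m rfl
  exact momentRec_even hA hM0 hMempty hrec hμ0 hμ hμ1 hμ2 (by nlinarith) (by nlinarith) hD hG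
    m le_rfl _ (Subset.refl _)

end Deviation

section Frobenius

open NumberField

/-- Existence of Frobenius elements in a Galois number field. -/
lemma exists_frobenius (E : Type) [Field E] [NumberField E] [IsGalois ℚ E] (p : ℕ)
    [hp : Fact p.Prime] :
    ∃ (k : Type) (_ : Field k) (_ : Finite k) (_ : Algebra (ZMod p) k) (π : 𝓞 E →+* k)
      (φ : Gal(E/ℚ)), ∀ x : 𝓞 E, π (φ • x) = π x ^ p := by
  have hprime : (Ideal.span {(p : ℤ)}).IsPrime :=
    (Ideal.span_singleton_prime (by exact_mod_cast hp.out.ne_zero)).2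
      (Nat.prime_iff_prime_int.1 hp.out)
  obtain ⟨Q, hQ, hQp⟩ := Ideal.exists_ideal_over_prime_of_isIntegral_of_isDomain
    (S := 𝓞 E) (Ideal.span {(p : ℤ)}) (by
      rw [(RingHom.injective_iff_ker_eq_bot _).1 (FaithfulSMul.algebraMap_injective ℤ (𝓞 E))]
      exact bot_le)
  have hpQ : (p : 𝓞 E) ∈ Q := by
    have : (p : ℤ) ∈ Q.comap (algebraMap ℤ (𝓞 E)) := by
      rw [hQp]; exact Ideal.mem_span_singleton_self _
    simpa using this
  have hQ0 : Q ≠ ⊥ := by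
    rintro rfl
    have : (p : 𝓞 E) = 0 := by simpa using hpQ
    exact hp.out.ne_zero (by exact_mod_cast this)
  have hfin : Finite (𝓞 E ⧸ Q) := Ideal.finiteQuotientOfFreeOfNeBot Q hQ0
  have hgal := IsGaloisGroup.of_isFractionRing Gal(E/ℚ) ℤ (𝓞 E) ℚ E
  obtain ⟨φ, hφ⟩ := IsArithFrobAt.exists_of_isInvariant ℤ Gal(E/ℚ) Q
  have hmax : Q.IsMaximal := hQ.isMaximal hQ0
  have hchar : CharP (𝓞 E ⧸ Q) p := (CharP.charP_iff_prime_eq_zero hp.out).2 (by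
    rw [← map_natCast (Ideal.Quotient.mk Q)]
    exact Ideal.Quotient.eq_zero_iff_mem.2 hpQ)
  refine ⟨𝓞 E ⧸ Q, Ideal.Quotient.field Q, hfin, ZMod.algebra _ p, Ideal.Quotient.mk Q, φ,
    fun x => ?_⟩
  have hcard : Nat.card (ℤ ⧸ Q.under ℤ) = p := by
    rw [show Q.under ℤ = Ideal.span {(p : ℤ)} from hQp,
      Nat.card_congr (Int.quotientSpanEquivZMod p).toEquiv, Int.natAbs_natCast, Nat.card_zmod]
  have := hφ x
  rw [hcard] at this
  exact Ideal.Quotient.eq.2 this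

end Frobenius

section PermGroup

variable {α : Type*} [Finite α]

/-- A transitive permutation group containing a transposition and an element that fixes a point
and permutes the remaining ones transitively is the full symmetric group. -/
lemma subgroup_perm_eq_top {H : Subgroup (Equiv.Perm α)}
    (htrans : ∀ x y : α, ∃ g ∈ H, g x = y)
    {σ : Equiv.Perm α} (hσ : σ ∈ H) {x₀ : α} (hx₀ : σ x₀ = x₀)
    (hσ' : ∀ y z : α, y ≠ x₀ → z ≠ x₀ → ∃ i : ℕ, (σ ^ i) y = z)
    {τ : Equiv.Perm α} (hτ : τ ∈ H) (hswap : τ.IsSwap) : H = ⊤ := by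
  have conj : ∀ g ∈ H, ∀ a b : α, Equiv.swap a b ∈ H → Equiv.swap (g a) (g b) ∈ H := by
    intro g hg a b hab
    rw [Equiv.swap_apply_apply]
    exact H.mul_mem (H.mul_mem hg hab) (H.inv_mem hg)
  obtain ⟨a, b, hab, rfl⟩ := hswap
  obtain ⟨g, hg, hga⟩ := htrans a x₀
  have hc := conj g hg a b hτ
  rw [hga] at hc
  have hc0 : g b ≠ x₀ := fun h => hab (g.injective (hga.trans h.symm))
  have hfix : ∀ i : ℕ, (σ ^ i) x₀ = x₀ := by
    intro i
    induction i with
    | zero => rfl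
    | succ i ih => rw [pow_succ, Equiv.Perm.mul_apply, hx₀, ih]
  have hall : ∀ z, z ≠ x₀ → Equiv.swap x₀ z ∈ H := by
    intro z hz
    obtain ⟨i, hi⟩ := hσ' (g b) z hc0 hz
    have := conj (σ ^ i) (H.pow_mem hσ i) _ _ hc
    rwa [hfix, hi] at this
  rw [eq_top_iff, ← Equiv.Perm.closure_isSwap, Subgroup.closure_le]
  rintro _ ⟨y, z, hyz, rfl⟩
  rw [SetLike.mem_coe]
  by_cases hy : y = x₀
  · exact hy ▸ hall z (fun h => hyz (hy.trans h.symm))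
  by_cases hz : z = x₀
  · rw [hz, Equiv.swap_comm]
    exact hall y hy
  have := conj _ (hall y hy) x₀ z (hall z hz)
  rwa [Equiv.swap_apply_left, Equiv.swap_apply_of_ne_of_ne hz hyz.symm] at this

end PermGroup

section FrobeniusRoots

open NumberField

variable {E : Type} [Field E] [NumberField E] [IsGalois ℚ E] {p : ℕ} [hp : Fact p.Prime]

/-- If `f` is squarefree modulo `p`, then some automorphism acts on the roots of `f` in the same
way as the Frobenius map acts on the roots modulo `p`; here `d x` is the minimal polynomial of the
reduction of `x`. -/
lemma exists_frobenius_integral {f : ℤ[X]} (hf : f.Monic)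
    (hs : (f.map (algebraMap ℤ (𝓞 E))).Splits)
    (hsq : Squarefree (f.map (Int.castRingHom (ZMod p)))) :
    (f.map (algebraMap ℤ (𝓞 E))).roots.Nodup ∧
    ∃ φ : Gal(E/ℚ), ∃ d : 𝓞 E → (ZMod p)[X],
      (∀ x, IsRoot (f.map (algebraMap ℤ (𝓞 E))) x →
        (d x).Monic ∧ Irreducible (d x) ∧ d x ∣ f.map (Int.castRingHom (ZMod p))) ∧
      (∀ x, IsRoot (f.map (algebraMap ℤ (𝓞 E))) x → (φ • x = x ↔ (d x).natDegree = 1)) ∧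
      (∀ x y, IsRoot (f.map (algebraMap ℤ (𝓞 E))) x → IsRoot (f.map (algebraMap ℤ (𝓞 E))) y →
        d x = d y → ∃ i : ℕ, φ ^ i • x = y) ∧
      (∀ h, h.Monic → Irreducible h → h ∣ f.map (Int.castRingHom (ZMod p)) →
        ∃ x, IsRoot (f.map (algebraMap ℤ (𝓞 E))) x ∧ d x = h) := by
  obtain ⟨k, _, _, _, π, φ, hπφ⟩ := exists_frobenius E p
  set F := f.map (algebraMap ℤ (𝓞 E)) with hF
  set fb := f.map (Int.castRingHom (ZMod p)) with hfb
  have hFm : F.Monic := hf.map _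
  have hfbm : fb.Monic := hf.map _
  have hcomp : F.map π = fb.map (algebraMap (ZMod p) k) := by
    rw [hF, hfb, Polynomial.map_map, Polynomial.map_map]
    congr 1
    exact RingHom.ext_int _ _
  have hne : F.map π ≠ 0 := (hFm.map π).ne_zero
  have hsep : (fb.map (algebraMap (ZMod p) k)).Separable :=
    (PerfectField.separable_iff_squarefree.2 hsq).map
  have hroots := hs.roots_map_of_ne_zero hne
  have hnodup : (F.roots.map π).Nodup := by
    rw [← hroots, hcomp]
    exact nodup_roots hsep
  have hmem : ∀ x, F.IsRoot x ↔ x ∈ F.roots := fun x => by rw [mem_roots hFm.ne_zero]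
  have hinj : ∀ x y, F.IsRoot x → F.IsRoot y → π x = π y → x = y := fun x y hx hy h =>
    Multiset.inj_on_of_nodup_map hnodup x ((hmem x).1 hx) y ((hmem y).1 hy) h
  have hFφ : ∀ x, F.IsRoot x → F.IsRoot (φ • x) := by
    intro x hx
    have h := aeval_algHom_apply (MulSemiringAction.toAlgHom ℤ (𝓞 E) φ) x f
    rw [IsRoot.def, hF, eval_map_algebraMap] at hx ⊢
    rw [hx, map_zero] at h
    exact h
  have hFφi : ∀ (i : ℕ) x, F.IsRoot x → F.IsRoot (φ ^ i • x) := by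
    intro i x hx
    induction i with
    | zero => simpa using hx
    | succ i ih => rw [pow_succ', mul_smul]; exact hFφ _ ih
  have hπφi : ∀ (i : ℕ) x, π (φ ^ i • x) = π x ^ p ^ i := by
    intro i x
    induction i with
    | zero => simp
    | succ i ih => rw [pow_succ', mul_smul, hπφ, ih, ← pow_mul, pow_succ]
  have hint : ∀ z : k, IsIntegral (ZMod p) z := fun z => Algebra.IsIntegral.isIntegral z
  have haeval : ∀ x, F.IsRoot x → aeval (π x) fb = 0 := by
    intro x hx
    rw [aeval_def, ← eval_map, ← hcomp, eval_map, eval₂_hom, hx.eq_zero, map_zero]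
  refine ⟨Multiset.Nodup.of_map π hnodup, φ, fun x => minpoly (ZMod p) (π x), ?_, ?_, ?_, ?_⟩
  · intro x hx
    exact ⟨minpoly.monic (hint _), minpoly.irreducible (hint _), minpoly.dvd _ _ (haeval x hx)⟩
  · intro x hx
    constructor
    · intro h
      have h1 : π x ^ p = π x := by rw [← hπφ, h]
      have h2 : minpoly (ZMod p) (π x) ∣ X ^ Nat.card (ZMod p) ^ 1 - X := by
        refine minpoly.dvd _ _ ?_
        simp [h1]
      have h3 := (minpoly.irreducible (hint (π x))).natDegree_dvd_of_dvd_X_pow_card_pow_sub_X h2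
      exact Nat.dvd_one.1 h3
    · intro h
      obtain ⟨c, hc⟩ := minpoly.natDegree_eq_one_iff.1 h
      refine hinj _ _ (hFφ x hx) hx ?_
      rw [hπφ, ← hc, ← map_pow, ZMod.pow_card]
  · intro x y hx hy hxy
    obtain ⟨g, hg⟩ := (isConjRoot_iff_exists_algEquiv (K := ZMod p) (L := k)
      (x := π y) (y := π x)).1 hxy.symm
    obtain ⟨i, hi⟩ := FiniteField.exists_forall_apply_eq_pow (ZMod p) p k g
    refine ⟨i, hinj _ _ (hFφi i x hx) hy ?_⟩
    rw [hπφi, ← hg, hi, Nat.card_zmod]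
  · intro h hm hi hdvd
    have hsp : (fb.map (algebraMap (ZMod p) k)).Splits := hcomp ▸ hs.map π
    obtain ⟨β, hβ⟩ := (hsp.of_dvd (hfbm.map _).ne_zero
      (Polynomial.map_dvd (algebraMap (ZMod p) k) hdvd)).exists_eval_eq_zero (by
        rw [degree_map]; exact hi.degree_pos.ne')
    have hβ' : β ∈ (F.map π).roots := by
      rw [mem_roots hne, hcomp]
      exact IsRoot.dvd hβ (Polynomial.map_dvd _ hdvd)
    rw [hroots, Multiset.mem_map] at hβ'
    obtain ⟨x, hx, rfl⟩ := hβ'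
    refine ⟨x, (hmem x).2 hx, (minpoly.eq_of_irreducible_of_monic hi ?_ hm).symm⟩
    rw [aeval_def, ← eval_map]; exact hβ
end FrobeniusRoots

section SnCriterion

open NumberField

variable {n : ℕ} {a : Fin n → ℤ} {E : Type} [Field E] [NumberField E]

/-- The Galois group of `ratPoly n a` as a group of permutations of the roots. -/
def rootPerms (n : ℕ) (a : Fin n → ℤ) (E : Type) [Field E] [NumberField E]
    [Fact (((ratPoly n a).map (algebraMap ℚ E)).Splits)] :
    Subgroup (Equiv.Perm ((ratPoly n a).rootSet E)) :=
  (Gal.galActionHom (ratPoly n a) E).range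

/-- The cycle type of Frobenius: `e x + 1` is the length of the cycle of `x`. -/
lemma exists_perm_of_hasSplitType [IsGalois ℚ E]
    [hsplit : Fact (((ratPoly n a).map (algebraMap ℚ E)).Splits)] {r : Fin n → ℕ} {p : ℕ}
    [hp : Fact p.Prime] (h : HasSplitType n r a p) :
    Nat.card ((ratPoly n a).rootSet E) = n ∧
    ∃ σ ∈ rootPerms n a E, ∃ e : (ratPoly n a).rootSet E → Fin n,
      (∀ x, σ x = x ↔ (e x : ℕ) = 0) ∧ (∀ x, r (e x) ≠ 0) ∧
      (∀ x y, r (e x) = 1 → e x = e y → ∃ i : ℕ, (σ ^ i) x = y) ∧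
      ∀ h0 : 0 < n, Nat.card {x // σ x = x} = r ⟨0, h0⟩ := by
  set f := intPoly n a with hf
  set P := ratPoly n a with hP
  have hfm : f.Monic := intPoly_monic a
  have hPm : P.Monic := intPoly_map_monic _ a
  have hPE : P.map (algebraMap ℚ E) = f.map (algebraMap ℤ E) := by
    rw [hP, ratPoly, Polynomial.map_map]
    congr 1
    exact RingHom.ext_int _ _
  have hFE : (f.map (algebraMap ℤ (𝓞 E))).map (algebraMap (𝓞 E) E) = f.map (algebraMap ℤ E) := by
    rw [Polynomial.map_map, ← IsScalarTower.algebraMap_eq]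
  have hinjE : Function.Injective (algebraMap (𝓞 E) E) := FaithfulSMul.algebraMap_injective _ _
  have hsp : (P.map (algebraMap ℚ E)).Splits := hsplit.out
  have hint : ∀ x : E, (f.map (algebraMap ℤ E)).IsRoot x → IsIntegral ℤ x := fun x hx =>
    ⟨f, hfm, by rwa [IsRoot.def, eval_map] at hx⟩
  have hsO : (f.map (algebraMap ℤ (𝓞 E))).Splits := by
    refine Splits.of_splits_map_of_injective hinjE (by rwa [hFE, ← hPE]) fun x hx => ?_
    rw [hFE] at hx
    exact ⟨⟨x, hint x (isRoot_of_mem_roots hx)⟩, rfl⟩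
  obtain ⟨hnodup, φ, d, hd1, hd2, hd3, hd4⟩ := exists_frobenius_integral (p := p) hfm hsO h.1
  have hmemE : ∀ x : E, x ∈ P.rootSet E ↔ (f.map (algebraMap ℤ E)).IsRoot x := by
    intro x
    rw [mem_rootSet_of_ne hPm.ne_zero, ← hPE, IsRoot.def, eval_map_algebraMap]
  let ι : P.rootSet E → 𝓞 E := fun x => ⟨x, hint x ((hmemE x).1 x.2)⟩
  have hι : ∀ x, algebraMap (𝓞 E) E (ι x) = x := fun x => rfl
  have hιroot : ∀ x, (f.map (algebraMap ℤ (𝓞 E))).IsRoot (ι x) := by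
    intro x
    have := (hmemE x).1 x.2
    rw [← hFE, ← hι x] at this
    exact this.of_map hinjE
  have hιsurj : ∀ y, (f.map (algebraMap ℤ (𝓞 E))).IsRoot y → ∃ x, ι x = y := by
    intro y hy
    refine ⟨⟨algebraMap (𝓞 E) E y, (hmemE _).2 ?_⟩, rfl⟩
    rw [← hFE]
    exact hy.map
  have hιinj : ∀ x y, ι x = ι y → x = y := fun x y hxy =>
    Subtype.ext (by rw [← hι x, ← hι y, hxy])
  set σ : Equiv.Perm (P.rootSet E) := Gal.galActionHom P E (Gal.restrict P E φ) with hσ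
  have hσι : ∀ x, ι (σ x) = φ • ι x := by
    intro x
    apply hinjE
    rw [hι, hσ, Gal.galActionHom_restrict]
    rfl
  have hσιi : ∀ (i : ℕ) x, ι ((σ ^ i) x) = φ ^ i • ι x := by
    intro i x
    induction i with
    | zero => simp
    | succ i ih => rw [pow_succ', Equiv.Perm.mul_apply, hσι, ih, pow_succ', mul_smul]
  set fb := f.map (Int.castRingHom (ZMod p)) with hfb
  have hfbm : fb.Monic := hfm.map _
  have hcard := (splitTypeOf_iff.1 h).2
  have hdeg : ∀ x, (d (ι x)).natDegree - 1 < n ∧ 0 < (d (ι x)).natDegree := by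
    intro x
    obtain ⟨h1, h2, h3⟩ := hd1 _ (hιroot x)
    have h4 := natDegree_le_of_dvd h3 hfbm.ne_zero
    rw [hfb, hf, intPoly_map_natDegree] at h4
    have h5 := h2.natDegree_pos
    exact ⟨by omega, h5⟩
  let e : P.rootSet E → Fin n := fun x => ⟨(d (ι x)).natDegree - 1, (hdeg x).1⟩
  have he : ∀ x, (d (ι x)).natDegree = (e x : ℕ) + 1 := by
    intro x
    have := (hdeg x).2
    change _ = (d (ι x)).natDegree - 1 + 1
    omega
  have hdmem : ∀ x, d (ι x) ∈ (monicIrred p ((e x : ℕ) + 1)).filter (· ∣ fb) := by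
    intro x
    obtain ⟨h1, h2, h3⟩ := hd1 _ (hιroot x)
    exact mem_filter.2 ⟨(mem_monicIrred (Nat.succ_ne_zero _)).2 ⟨h1, h2, he x⟩, h3⟩
  have hfix : ∀ x, σ x = x ↔ (e x : ℕ) = 0 := by
    intro x
    have h1 : σ x = x ↔ φ • ι x = ι x := by
      rw [← hσι]
      exact ⟨fun h => by rw [h], fun h => hιinj _ _ h⟩
    rw [h1, hd2 _ (hιroot x), he]
    omega
  have hconj : ∀ x y, d (ι x) = d (ι y) → ∃ i : ℕ, (σ ^ i) x = y := by
    intro x y hxy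
    obtain ⟨i, hi⟩ := hd3 _ _ (hιroot x) (hιroot y) hxy
    exact ⟨i, hιinj _ _ (by rw [hσιi, hi])⟩
  refine ⟨?_, σ, ⟨_, rfl⟩, e, hfix, ?_, ?_, ?_⟩
  · rw [Nat.card_eq_fintype_card, card_rootSet_eq_natDegree_iff_of_splits hPm.ne_zero hsp |>.2]
    · exact intPoly_map_natDegree _ a
    · rw [← nodup_aroots_iff_of_splits hPm.ne_zero hsp, aroots_def, hPE, ← hFE,
        hsO.roots_map_of_injective hinjE]
      exact hnodup.map hinjE
  · intro x h0
    have := hcard (e x)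
    rw [h0, card_eq_zero] at this
    have h1 := hdmem x
    rw [this] at h1
    exact absurd h1 (notMem_empty _)
  · intro x y hx hxy
    have h1 := hcard (e x)
    rw [hx] at h1
    exact hconj x y (card_le_one.1 h1.le _ (hdmem x) _ (hxy ▸ hdmem y))
  · intro h0
    rw [Nat.card_eq_fintype_card, Fintype.card_subtype, ← hcard ⟨0, h0⟩]
    refine card_bij (fun x _ => d (ι x)) ?_ ?_ ?_
    · intro x hx
      have h1 := (hfix x).1 (mem_filter.1 hx).2
      have h2 := hdmem x
      rwa [show e x = ⟨0, h0⟩ from Fin.ext h1] at h2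
    · intro x hx y _ hxy
      obtain ⟨i, hi⟩ := hconj x y hxy
      have h1 : (σ ^ i) x = x := Function.IsFixedPt.perm_pow (mem_filter.1 hx).2 i
      rw [← hi, h1]
    · intro g hg
      obtain ⟨hg1, hg2⟩ := mem_filter.1 hg
      obtain ⟨h1, h2, h3⟩ := (mem_monicIrred (Nat.succ_ne_zero _)).1 hg1
      obtain ⟨y, hy, rfl⟩ := hd4 g h1 h2 hg2
      obtain ⟨x, rfl⟩ := hιsurj y hy
      refine ⟨x, mem_filter.2 ⟨mem_univ _, (hfix x).2 ?_⟩, rfl⟩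
      have := he x
      simp only at h3
      omega

end SnCriterion

section SnTypes

variable {n : ℕ} {a : Fin n → ℤ}

/-- The splitting type of an irreducible polynomial. -/
def typeIrred (n : ℕ) : Fin n → ℕ := fun i => if (i : ℕ) + 1 = n then 1 else 0

/-- The splitting type of the product of a linear factor and an irreducible factor. -/
def typePoint (n : ℕ) : Fin n → ℕ := fun i =>
  (if (i : ℕ) = 0 then 1 else 0) + if (i : ℕ) + 2 = n then 1 else 0

/-- The splitting type of a polynomial with one quadratic and otherwise linear factors. -/
def typeSwap (n : ℕ) : Fin n → ℕ := fun i =>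
  (if (i : ℕ) = 0 then n - 2 else 0) + if (i : ℕ) = 1 then 1 else 0

lemma sum_typeIrred (hn : 2 ≤ n) : ∑ i : Fin n, ((i : ℕ) + 1) * typeIrred n i = n := by
  simp only [typeIrred]
  rw [Fin.sum_univ_eq_sum_range (fun i => (i + 1) * if i + 1 = n then 1 else 0) n,
    sum_eq_single (n - 1)]
  · rw [if_pos (by omega)]; omega
  · intro i _ hi
    rw [if_neg (by omega), mul_zero]
  · intro h
    exact absurd (mem_range.2 (by omega)) h

lemma sum_typePoint (hn : 2 ≤ n) : ∑ i : Fin n, ((i : ℕ) + 1) * typePoint n i = n := by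
  simp only [typePoint]
  rw [Fin.sum_univ_eq_sum_range (fun i => (i + 1) *
    ((if i = 0 then 1 else 0) + if i + 2 = n then 1 else 0)) n]
  simp only [mul_add, sum_add_distrib]
  rw [sum_eq_single 0, sum_eq_single (n - 2)]
  · rw [if_pos rfl, if_pos (by omega)]; omega
  · intro i _ hi
    rw [if_neg (by omega), mul_zero]
  · intro h
    exact absurd (mem_range.2 (by omega)) h
  · intro i _ hi
    rw [if_neg hi, mul_zero]
  · intro h
    exact absurd (mem_range.2 (by omega)) h

lemma sum_typeSwap (hn : 2 ≤ n) : ∑ i : Fin n, ((i : ℕ) + 1) * typeSwap n i = n := by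
  simp only [typeSwap]
  rw [Fin.sum_univ_eq_sum_range (fun i => (i + 1) *
    ((if i = 0 then n - 2 else 0) + if i = 1 then 1 else 0)) n]
  simp only [mul_add, sum_add_distrib]
  rw [sum_eq_single 0, sum_eq_single 1]
  · rw [if_pos rfl, if_pos rfl]; omega
  · intro i _ hi
    rw [if_neg hi, mul_zero]
  · intro h
    exact absurd (mem_range.2 (by omega)) h
  · intro i _ hi
    rw [if_neg hi, mul_zero]
  · intro h
    exact absurd (mem_range.2 (by omega)) h

/-- A polynomial with suitable splitting types modulo three primes is an `S_n`-polynomial. -/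
lemma isSnPoly_of_hasSplitType (hn : 2 ≤ n) {p₁ p₂ p₃ : ℕ} (hp₁ : p₁.Prime) (hp₂ : p₂.Prime)
    (hp₃ : p₃.Prime) (h₁ : HasSplitType n (typeIrred n) a p₁)
    (h₂ : HasSplitType n (typePoint n) a p₂) (h₃ : HasSplitType n (typeSwap n) a p₃) :
    IsSnPoly n a := by
  have := Fact.mk hp₁
  have := Fact.mk hp₂
  have := Fact.mk hp₃
  have : NumberField (ratPoly n a).SplittingField := { }
  have : IsSplittingField ℚ (ratPoly n a).SplittingField (ratPoly n a) := by
    convert IsSplittingField.splittingField (ratPoly n a)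
    exact Subsingleton.elim _ _
  have : IsGalois ℚ (ratPoly n a).SplittingField := 
    isGalois_iff.2 ⟨inferInstance, Normal.of_isSplittingField (ratPoly n a)⟩
  have hsplit : Fact (((ratPoly n a).map (algebraMap ℚ (ratPoly n a).SplittingField)).Splits) :=
    ⟨SplittingField.splits _⟩
  obtain ⟨hcard, σ₁, hσ₁, e₁, -, hr₁, hc₁, -⟩ :=
    exists_perm_of_hasSplitType (E := (ratPoly n a).SplittingField) h₁
  obtain ⟨-, σ₂, hσ₂, e₂, hf₂, hr₂, hc₂, hz₂⟩ :=
    exists_perm_of_hasSplitType (E := (ratPoly n a).SplittingField) h₂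
  obtain ⟨-, σ₃, hσ₃, e₃, -, -, -, hz₃⟩ :=
    exists_perm_of_hasSplitType (E := (ratPoly n a).SplittingField) h₃
  let α := (ratPoly n a).rootSet (ratPoly n a).SplittingField
  have hcard : Nat.card α = n := hcard
  have htrans : ∀ x y : α, ∃ g ∈ rootPerms n a (ratPoly n a).SplittingField, g x = y := by
    intro x y
    have key : ∀ x, ((e₁ x : Fin n) : ℕ) + 1 = n := by
      intro x
      by_contra hne
      exact hr₁ x (if_neg hne)
    obtain ⟨i, hi⟩ := hc₁ x y (if_pos (key x)) (Fin.ext (by have := key x; have := key y; omega))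
    exact ⟨σ₁ ^ i, Subgroup.pow_mem _ hσ₁ i, hi⟩
  have hswap : σ₃.IsSwap := by
    rw [← Equiv.Perm.card_support_eq_two]
    have h1 := hz₃ (by omega)
    rw [Nat.card_eq_fintype_card, Fintype.card_subtype] at h1
    have h2 := card_filter_add_card_filter_not (s := (univ : Finset α)) (fun x => σ₃ x = x)
    have h3 : univ.filter (fun x => ¬ σ₃ x = x) = σ₃.support := by
      ext x; simp
    rw [h1, h3, card_univ, ← Nat.card_eq_fintype_card, hcard] at h2
    simp only [typeSwap] at h2
    simp at h2
    omega
  have hpoint : ∃ σ ∈ rootPerms n a (ratPoly n a).SplittingField, ∃ x₀ : α, σ x₀ = x₀ ∧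
      ∀ y z : α, y ≠ x₀ → z ≠ x₀ → ∃ i : ℕ, (σ ^ i) y = z := by
    rcases hn.eq_or_lt with h2 | h3
    · have : Nonempty α := (Nat.card_pos_iff.1 (by omega)).1
      obtain ⟨x₀⟩ := this
      refine ⟨1, Subgroup.one_mem _, x₀, rfl, fun y z hy hz => ⟨0, ?_⟩⟩
      rw [pow_zero, Equiv.Perm.one_apply]
      by_contra hyz
      have h4 : #({x₀, y, z} : Finset α) = 3 := card_eq_three.2
        ⟨x₀, y, z, hy.symm, hz.symm, hyz, rfl⟩
      have h5 := card_le_univ ({x₀, y, z} : Finset α)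
      rw [← Nat.card_eq_fintype_card, hcard] at h5
      omega
    · have h1 := hz₂ (by omega)
      simp only [typePoint] at h1
      rw [if_true, if_neg (by omega), add_zero, Nat.card_eq_one_iff_exists] at h1
      obtain ⟨⟨x₀, hx₀⟩, huniq⟩ := h1
      have key : ∀ y, y ≠ x₀ → ((e₂ y : Fin n) : ℕ) ≠ 0 ∧ ((e₂ y : Fin n) : ℕ) + 2 = n := by
        intro y hy
        have hy0 : ((e₂ y : Fin n) : ℕ) ≠ 0 := fun h =>
          hy (congrArg Subtype.val (huniq ⟨y, (hf₂ y).2 h⟩))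
        refine ⟨hy0, ?_⟩
        by_contra hne
        refine hr₂ y ?_
        simp only [typePoint]
        rw [if_neg hy0, if_neg hne]
      refine ⟨σ₂, hσ₂, x₀, hx₀, fun y z hy hz => hc₂ y z ?_ (Fin.ext ?_)⟩
      · simp only [typePoint]
        rw [if_neg (key y hy).1, if_pos (key y hy).2]
      · have := (key y hy).2
        have := (key z hz).2
        omega
  obtain ⟨σ, hσ, x₀, hx₀, hσ'⟩ := hpoint
  have htop := subgroup_perm_eq_top htrans hσ hx₀ hσ' hσ₃ (by convert hswap)
  have hbij : Function.Bijective
      (Gal.galActionHom (ratPoly n a) (ratPoly n a).SplittingField) :=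
    ⟨Gal.galActionHom_injective _ _, MonoidHom.range_eq_top.1 htop⟩
  have hα : α ≃ Fin n := Nat.equivFinOfCardPos (by omega) |>.trans (finCongr hcard)
  exact ⟨(MulEquiv.ofBijective _ hbij).trans hα.permCongrHom⟩

end SnTypes

section Sieve

variable {n : ℕ}

lemma card_coeffBox (n N : ℕ) : (#(coeffBox n N) : ℝ) = (2 * N + 1 : ℝ) ^ n := by
  have h : ((N : ℤ) + 1 + N).toNat = 2 * N + 1 := by omega
  simp [coeffBox, Fintype.card_piFinset, h]

/-- Second moment bound for the number of vectors that miss the splitting type `r` modulo all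
primes up to `y`. -/
lemma exists_card_missing_le (hn : 2 ≤ n) {r : Fin n → ℕ}
    (hr : ∑ i : Fin n, ((i : ℕ) + 1) * r i = n) :
    ∃ A, 0 ≤ A ∧ ∀ y N : ℕ, 1 ≤ y → y ^ 2 ≤ 2 * N + 1 →
      (#((coeffBox n N).filter fun a => ∀ p ∈ primesTo y, ¬ HasSplitType n r a p) : ℝ) *
        (splitDelta n r * #(primesTo y)) ^ 2 ≤
      (((A * (1 + Real.log y) + 4) ^ 2) * #(primesTo y) +
        (#(primesTo y) : ℝ) ^ 2 * (2 ^ n * ((y : ℝ) ^ 2 / (2 * N + 1)))) *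
        (2 * N + 1 : ℝ) ^ n := by
  obtain ⟨A, hA, h⟩ := exists_residueMean_moment_le hn hr
  refine ⟨2 * A, by positivity, fun y N hy hyN => ?_⟩
  obtain ⟨hmom, -⟩ := h y 2 _ _ rfl rfl
  have hbox := abs_boxMean_moment_sub_le (n := n) (S₀ := primesTo y) (Y := splitDev r) (k := 2)
    (fun p hp => prime_of_mem_primesTo hp) (fun p _ => periodicMod_splitDev r p)
    (fun p _ a => abs_splitDev_le_one hn hr p a) hy (fun p hp => le_of_mem_primesTo hp) hyN
  have hH := sum_one_div_primesTo_le y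
  have hH0 : 0 ≤ ∑ p ∈ primesTo y, 1 / (p : ℝ) := sum_nonneg fun _ _ => by positivity
  set R := residueMean (∏ p ∈ primesTo y, p) fun a => (∑ p ∈ primesTo y, splitDev r p a) ^ 2
  set B := boxMean N fun a => (∑ p ∈ primesTo y, splitDev r p a) ^ 2 with hB
  have hD : ((2 : ℕ) * A * ∑ p ∈ primesTo y, 1 / (p : ℝ) + 2 ^ 2) ^ 2 ≤
      (2 * A * (1 + Real.log y) + 4) ^ 2 := by
    push_cast
    have : 2 * A * ∑ p ∈ primesTo y, 1 / (p : ℝ) ≤ 2 * A * (1 + Real.log y) := by gcongr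
    have h0 : 0 ≤ 2 * A * ∑ p ∈ primesTo y, 1 / (p : ℝ) := by positivity
    exact pow_le_pow_left₀ (by linarith) (by linarith) 2
  have hBle : B ≤ ((2 * A * (1 + Real.log y) + 4) ^ 2) * #(primesTo y) +
      (#(primesTo y) : ℝ) ^ 2 * (2 ^ n * ((y : ℝ) ^ 2 / (2 * N + 1))) := by
    have h1 : |R| ≤ ((2 * A * (1 + Real.log y) + 4) ^ 2) * #(primesTo y) := by
      refine hmom.trans ?_
      rw [Nat.div_self two_pos, pow_one]
      gcongr
    linarith [abs_le.1 hbox, abs_le.1 h1]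
  have hpos : (0 : ℝ) < (2 * N + 1 : ℝ) ^ n := by positivity
  refine le_trans ?_ (mul_le_mul_of_nonneg_right hBle hpos.le)
  rw [hB, boxMean, div_mul_cancel₀ _ hpos.ne', ← nsmul_eq_mul, ← sum_const]
  refine le_trans (sum_le_sum fun a ha => ?_) (sum_le_sum_of_subset_of_nonneg
    (filter_subset _ _) fun _ _ _ => sq_nonneg _)
  have h1 : ∑ p ∈ primesTo y, splitDev r p a = -(splitDelta n r * #(primesTo y)) := by
    rw [sum_congr rfl fun p hp => ?_, sum_const, nsmul_eq_mul, mul_comm, ← neg_mul]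
    rw [splitDev, splitInd, if_neg ((mem_filter.1 ha).2 p hp), zero_sub]
  rw [h1, neg_sq]

/-- Few vectors in the box miss the splitting type `r` modulo all primes up to `N ^ (1 / 4)`. -/
lemma eventually_card_missing_le (hn : 2 ≤ n) {r : Fin n → ℕ}
    (hr : ∑ i : Fin n, ((i : ℕ) + 1) * r i = n) :
    ∀ᶠ N : ℕ in atTop, (#((coeffBox n N).filter fun a =>
      ∀ p ∈ primesTo ⌊(N : ℝ) ^ (1 / 4 : ℝ)⌋₊, ¬ HasSplitType n r a p) : ℝ) ≤
      (N : ℝ) ^ (-(1 / 8) : ℝ) * (2 * N + 1 : ℝ) ^ n := by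
  obtain ⟨A, hA, h⟩ := exists_card_missing_le hn hr
  have hδ := splitDelta_pos r
  set δ := splitDelta n r
  have hz : Tendsto (fun N : ℕ => (N : ℝ) ^ (1 / 4 : ℝ)) atTop atTop :=
    (tendsto_rpow_atTop (by norm_num)).comp tendsto_natCast_atTop_atTop
  have h8 : Tendsto (fun z : ℝ => z ^ (1 / 8 : ℝ)) atTop atTop :=
    tendsto_rpow_atTop (by norm_num)
  have hlog := ((isLittleO_log_rpow_atTop (r := 1 / 8) (by norm_num)).const_mul_left A).bound
    (c := δ / 4) (by positivity)
  have hconst := h8.eventually_ge_atTop ((A + 4) / (δ / 4))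
  have hlarge := (tendsto_rpow_atTop (y := 3 / 2) (by norm_num)).eventually_ge_atTop
    (2 ^ n / δ ^ 2)
  filter_upwards [hz.eventually hlog, hz.eventually hconst, hz.eventually hlarge,
    hz.eventually eventually_rpow_le_card_primesTo, hz.eventually_ge_atTop 1,
    eventually_ge_atTop 1] with N hlog hconst hlarge hT hz1 hN1
  have hN0 : (0 : ℝ) < N := by exact_mod_cast hN1
  have hz4 : ((N : ℝ) ^ (1 / 4 : ℝ)) ^ 4 = N := by
    rw [← Real.rpow_natCast, ← Real.rpow_mul hN0.le]; norm_num
  have hz8 : (N : ℝ) ^ (-(1 / 8) : ℝ) = ((N : ℝ) ^ (1 / 4 : ℝ)) ^ (-(1 / 2) : ℝ) := by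
    rw [← Real.rpow_mul hN0.le]; norm_num
  rw [hz8]
  set z := (N : ℝ) ^ (1 / 4 : ℝ)
  have hz0 : 0 < z := by linarith
  set y := ⌊z⌋₊
  have hyz : (y : ℝ) ≤ z := Nat.floor_le hz0.le
  have hy1 : 1 ≤ y := Nat.le_floor (by simpa using hz1)
  have hyN : y ^ 2 ≤ 2 * N + 1 := by
    have h1 : (y : ℝ) ^ 2 ≤ 2 * N + 1 := by
      have : (y : ℝ) ^ 2 ≤ z ^ 2 := by gcongr
      nlinarith [sq_nonneg (z ^ 2 - 1)]
    exact_mod_cast h1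
  have hy0 : (0 : ℝ) < y := by exact_mod_cast hy1
  have hT0 : 0 < (#(primesTo y) : ℝ) := lt_of_lt_of_le (by positivity) hT
  have key := h y N hy1 hyN
  set T := (#(primesTo y) : ℝ)
  set E := (2 * N + 1 : ℝ) ^ n
  have hE : 0 < E := by positivity
  have hly : Real.log y ≤ Real.log z := Real.log_le_log hy0 hyz
  have hly0 : 0 ≤ Real.log y := Real.log_nonneg (by exact_mod_cast hy1)
  have hD : (A * (1 + Real.log y) + 4) ^ 2 ≤ δ ^ 2 / 4 * z ^ (1 / 4 : ℝ) := by
    rw [div_le_iff₀ (by positivity)] at hconst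
    rw [Real.norm_of_nonneg (mul_nonneg hA (hly0.trans hly)),
      Real.norm_of_nonneg (by positivity)] at hlog
    have h1 : A * (1 + Real.log y) + 4 ≤ δ / 2 * z ^ (1 / 8 : ℝ) := by
      have : A * Real.log y ≤ A * Real.log z := by gcongr
      linarith
    have h2 : (z ^ (1 / 8 : ℝ)) ^ 2 = z ^ (1 / 4 : ℝ) := by
      rw [← Real.rpow_natCast, ← Real.rpow_mul hz0.le]; norm_num
    calc _ ≤ (δ / 2 * z ^ (1 / 8 : ℝ)) ^ 2 := by gcongr
      _ = _ := by rw [mul_pow, h2]; ring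
  have h34 : z ^ (1 / 4 : ℝ) = z ^ (-(1 / 2) : ℝ) * z ^ (3 / 4 : ℝ) := by
    rw [← Real.rpow_add hz0]; norm_num
  have hfirst : (A * (1 + Real.log y) + 4) ^ 2 * T ≤
      1 / 4 * (z ^ (-(1 / 2) : ℝ) * (δ * T) ^ 2) := by
    calc _ ≤ δ ^ 2 / 4 * (z ^ (-(1 / 2) : ℝ) * T) * T := by
          gcongr
          refine hD.trans ?_
          rw [h34]
          gcongr
      _ = _ := by ring
  have hsecond : T ^ 2 * (2 ^ n * ((y : ℝ) ^ 2 / (2 * N + 1))) ≤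
      1 / 2 * (z ^ (-(1 / 2) : ℝ) * (δ * T) ^ 2) := by
    have h1 : (y : ℝ) ^ 2 / (2 * N + 1) ≤ 1 / 2 * z ^ (-2 : ℝ) := by
      rw [div_le_iff₀ (by positivity), ← hz4, Real.rpow_neg hz0.le]
      have h2 : (y : ℝ) ^ 2 ≤ z ^ 2 := by gcongr
      have h3 : z ^ (2 : ℝ) = z ^ 2 := Real.rpow_natCast z 2
      rw [h3]
      have h4 : 1 / 2 * (z ^ 2)⁻¹ * (2 * z ^ 4 + 1) = z ^ 2 + 1 / 2 * (z ^ 2)⁻¹ := by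
        field_simp
      rw [h4]
      have : 0 ≤ (z ^ 2)⁻¹ := by positivity
      linarith
    have h5 : z ^ (-(1 / 2) : ℝ) = z ^ (-2 : ℝ) * z ^ (3 / 2 : ℝ) := by
      rw [← Real.rpow_add hz0]; norm_num
    have h6 : (2 : ℝ) ^ n ≤ δ ^ 2 * z ^ (3 / 2 : ℝ) := by
      rw [div_le_iff₀ (by positivity)] at hlarge
      linarith
    calc _ ≤ T ^ 2 * ((δ ^ 2 * z ^ (3 / 2 : ℝ)) * (1 / 2 * z ^ (-2 : ℝ))) := by gcongr
      _ = _ := by rw [h5]; ring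
  refine le_of_mul_le_mul_right ?_ (by positivity : 0 < (δ * T) ^ 2)
  calc _ ≤ _ := key
    _ ≤ (z ^ (-(1 / 2) : ℝ) * (δ * T) ^ 2) * E := by
      gcongr
      have : 0 ≤ z ^ (-(1 / 2) : ℝ) * (δ * T) ^ 2 := by positivity
      linarith
    _ = _ := by ring

/-- Almost all polynomials in the box are `S_n`-polynomials, with a power saving. -/
lemma eventually_card_sdiff_P0_le (hn : 2 ≤ n) :
    ∀ᶠ N : ℕ in atTop, (#(coeffBox n N \ P0 n N) : ℝ) ≤
      3 * (N : ℝ) ^ (-(1 / 8) : ℝ) * (2 * N + 1 : ℝ) ^ n := by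
  filter_upwards [eventually_card_missing_le hn (sum_typeIrred hn),
    eventually_card_missing_le hn (sum_typePoint hn),
    eventually_card_missing_le hn (sum_typeSwap hn)] with N h₁ h₂ h₃
  set y := ⌊(N : ℝ) ^ (1 / 4 : ℝ)⌋₊
  have hsub : coeffBox n N \ P0 n N ⊆
      ((coeffBox n N).filter fun a => ∀ p ∈ primesTo y, ¬ HasSplitType n (typeIrred n) a p) ∪
      ((coeffBox n N).filter fun a => ∀ p ∈ primesTo y, ¬ HasSplitType n (typePoint n) a p) ∪
      ((coeffBox n N).filter fun a => ∀ p ∈ primesTo y, ¬ HasSplitType n (typeSwap n) a p) := by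
    intro a ha
    rw [Finset.mem_sdiff, P0, mem_filter, not_and] at ha
    by_contra hcon
    simp only [mem_union, mem_filter, ha.1, true_and, not_or, not_forall, not_not] at hcon
    obtain ⟨⟨⟨p₁, hp₁, h₁⟩, p₂, hp₂, h₂⟩, p₃, hp₃, h₃⟩ := hcon
    exact ha.2 ha.1 (isSnPoly_of_hasSplitType hn (prime_of_mem_primesTo hp₁)
      (prime_of_mem_primesTo hp₂) (prime_of_mem_primesTo hp₃) h₁ h₂ h₃)
  have h4 := (card_le_card hsub).trans ((card_union_le _ _).trans
    (Nat.add_le_add_right (card_union_le _ _) _))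
  have h5 : (#(coeffBox n N \ P0 n N) : ℝ) ≤ _ := Nat.cast_le.2 h4
  push_cast at h5
  linarith

end Sieve

section Assembly

variable {n : ℕ}

lemma abs_expN_sub_boxMean_le {N : ℕ} {F : (Fin n → ℤ) → ℝ} {B : ℝ} (hF : ∀ a, |F a| ≤ B)
    (hP : (P0 n N).Nonempty) :
    |expN n N F - boxMean N F| ≤
      2 * B * (#(coeffBox n N \ P0 n N) / (2 * N + 1 : ℝ) ^ n) := by
  have hsub : P0 n N ⊆ coeffBox n N := filter_subset _ _
  have hE : (#(coeffBox n N \ P0 n N) : ℝ) + #(P0 n N) = (2 * N + 1 : ℝ) ^ n := by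
    rw [← card_coeffBox]
    exact_mod_cast card_sdiff_add_card_eq_card hsub
  have hS := sum_sdiff (f := F) hsub
  have hP0 : (0 : ℝ) < #(P0 n N) := by exact_mod_cast hP.card_pos
  have hsum : ∀ s : Finset (Fin n → ℤ), |∑ a ∈ s, F a| ≤ #s * B := fun s => by
    rw [← nsmul_eq_mul]
    exact (abs_sum_le_sum_abs _ _).trans (sum_le_card_nsmul _ _ _ fun a _ => hF a)
  have h1 := hsum (P0 n N)
  have h2 := hsum (coeffBox n N \ P0 n N)
  rw [expN, boxMean, ← hS, ← hE]
  set Q := (#(coeffBox n N \ P0 n N) : ℝ)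
  set P := (#(P0 n N) : ℝ)
  set S := ∑ a ∈ P0 n N, F a
  set R := ∑ a ∈ coeffBox n N \ P0 n N, F a
  have hQ : 0 ≤ Q := Nat.cast_nonneg _
  have hQP : 0 < Q + P := by linarith
  have h3 : S / P - (R + S) / (Q + P) = (S / P * Q - R) / (Q + P) := by
    field_simp
    ring
  rw [h3, abs_div, abs_of_pos hQP, ← mul_div_assoc]
  gcongr
  have h4 : |S / P| ≤ B := by
    rw [abs_div, abs_of_pos hP0, div_le_iff₀ hP0]
    linarith
  calc |S / P * Q - R| ≤ |S / P * Q| + |R| := abs_sub _ _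
    _ ≤ B * Q + Q * B := by
      rw [abs_mul, abs_of_nonneg hQ]
      gcongr
    _ = 2 * B * Q := by ring

lemma P0_nonempty_of_card_sdiff_le {N : ℕ} {β : ℝ} (hβ : β < 1)
    (h : (#(coeffBox n N \ P0 n N) : ℝ) ≤ β * (2 * N + 1 : ℝ) ^ n) : (P0 n N).Nonempty := by
  by_contra hemp
  rw [not_nonempty_iff_eq_empty] at hemp
  rw [hemp, sdiff_empty, card_coeffBox] at h
  have hpos : (0 : ℝ) < (2 * N + 1 : ℝ) ^ n := by positivity
  exact absurd h (not_le.2 (mul_lt_of_lt_one_left hpos hβ))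

/-- Comparison of the moments over `S_n`-polynomials with the moments over residues. -/
lemma abs_expN_moment_sub_residueMean_le (hn : 2 ≤ n) {r : Fin n → ℕ}
    (hr : ∑ i : Fin n, ((i : ℕ) + 1) * r i = n) {y N k : ℕ} {β : ℝ} (hy : 1 ≤ y)
    (hyN : y ^ k ≤ 2 * N + 1) (hβ : β < 1)
    (h : (#(coeffBox n N \ P0 n N) : ℝ) ≤ β * (2 * N + 1 : ℝ) ^ n) :
    |expN n N (fun a => (∑ p ∈ primesTo y, splitDev r p a) ^ k) -
      residueMean (∏ p ∈ primesTo y, p) (fun a => (∑ p ∈ primesTo y, splitDev r p a) ^ k)| ≤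
      (#(primesTo y) : ℝ) ^ k * (2 * β + 2 ^ n * ((y : ℝ) ^ k / (2 * N + 1))) := by
  have hbox := abs_boxMean_moment_sub_le (n := n) (S₀ := primesTo y) (Y := splitDev r)
    (fun p hp => prime_of_mem_primesTo hp) (fun p _ => periodicMod_splitDev r p)
    (fun p _ a => abs_splitDev_le_one hn hr p a) hy (fun p hp => le_of_mem_primesTo hp) hyN
  have hF : ∀ a, |(∑ p ∈ primesTo y, splitDev r p a) ^ k| ≤ (#(primesTo y) : ℝ) ^ k :=
    fun a => by
      rw [abs_pow]
      gcongr
      refine (abs_sum_le_sum_abs _ _).trans ?_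
      simpa using sum_le_card_nsmul (primesTo y) _ 1 fun p _ => abs_splitDev_le_one hn hr p a
  have h1 := abs_expN_sub_boxMean_le hF (P0_nonempty_of_card_sdiff_le hβ h)
  have h2 : (#(coeffBox n N \ P0 n N) : ℝ) / (2 * N + 1 : ℝ) ^ n ≤ β :=
    (div_le_iff₀ (by positivity)).2 h
  have h3 : 2 * (#(primesTo y) : ℝ) ^ k *
      (#(coeffBox n N \ P0 n N) / (2 * N + 1 : ℝ) ^ n) ≤
      2 * (#(primesTo y) : ℝ) ^ k * β := by gcongr
  refine (abs_sub_le _ _ _).trans ((add_le_add (h1.trans h3) hbox).trans_eq ?_)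
  ring

lemma countSplit_sub_eq_sum (r : Fin n → ℕ) (a : Fin n → ℤ) (x : ℝ) :
    (countSplit n r a x : ℝ) - splitDelta n r * primePi x =
      ∑ p ∈ primesTo ⌊x⌋₊, splitDev r p a := by
  simp only [splitDev, sum_sub_distrib, sum_const, nsmul_eq_mul, splitInd]
  rw [sum_boole, primesTo, filter_filter, countSplit, primePi, mul_comm]

lemma CkrEven_two_mul (r : Fin n → ℕ) (m : ℕ) :
    CkrEven n r (2 * m) = gaussMoment (splitDelta n r - splitDelta n r ^ 2) m := by
  rw [CkrEven, gaussMoment, Nat.mul_div_cancel_left m two_pos]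

/-- Size of the constants of the moment recursion when `k ≤ L` and the reciprocals of the primes
sum to at most `exp L`. -/
lemma recConst_le_exp {A w H D G L : ℝ} {k : ℕ} (hA : 0 ≤ A) (hH0 : 0 ≤ H)
    (hw0 : 0 ≤ w) (hL : 1 ≤ L) (hk : (k : ℝ) ≤ L) (hH : H ≤ Real.exp L) (hw : w ≤ Real.exp L)
    (hAL : A * L + 1 ≤ Real.exp L) (hA3 : 2 * A + 3 ≤ Real.exp L)
    (hD : D = k * A * H + 2 ^ k)
    (hG : G = 2 ^ k * (2 * A * D ^ k * H + 1 + D ^ k + Nat.factorial k)) :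
    G * w ≤ Real.exp (6 * L ^ 2) := by
  have hL0 : 0 ≤ L := by linarith
  have h2k : (2 : ℝ) ^ k ≤ Real.exp L := by
    have h2 : (2 : ℝ) ≤ Real.exp 1 := by have := Real.exp_one_gt_d9; linarith
    calc (2 : ℝ) ^ k ≤ Real.exp 1 ^ k := by gcongr
      _ = Real.exp k := by rw [← Real.exp_nat_mul, mul_one]
      _ ≤ _ := Real.exp_le_exp.2 hk
  have hpow : ∀ {z c : ℝ}, 0 ≤ z → 0 ≤ c → z ≤ Real.exp (c * L) →
      z ^ k ≤ Real.exp (c * L ^ 2) := by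
    intro z c hz hc h
    calc z ^ k ≤ Real.exp (c * L) ^ k := by gcongr
      _ = Real.exp (c * L * k) := by rw [← Real.exp_nat_mul]; ring_nf
      _ ≤ _ := Real.exp_le_exp.2 (by
        rw [pow_two, ← mul_assoc]
        exact mul_le_mul_of_nonneg_left hk (by positivity))
  have hD0 : 0 ≤ D := by rw [hD]; positivity
  have hDle : D ≤ Real.exp (2 * L) := by
    rw [hD, two_mul, Real.exp_add]
    calc (k : ℝ) * A * H + 2 ^ k ≤ L * A * Real.exp L + Real.exp L := by gcongr
      _ = (A * L + 1) * Real.exp L := by ring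
      _ ≤ _ := by gcongr
  have hDk : D ^ k ≤ Real.exp (2 * L ^ 2) := hpow hD0 zero_le_two hDle
  have hfac : (Nat.factorial k : ℝ) ≤ Real.exp (2 * L ^ 2) := by
    calc (Nat.factorial k : ℝ) ≤ (k : ℝ) ^ k := by exact_mod_cast Nat.factorial_le_pow k
      _ ≤ _ := hpow (Nat.cast_nonneg k) zero_le_two (by
        have := Real.add_one_le_exp (2 * L)
        linarith)
  have hG' : G ≤ Real.exp L * (Real.exp L * (Real.exp (2 * L ^ 2) * Real.exp L)) := by
    have h1 : 1 ≤ Real.exp (2 * L ^ 2) := Real.one_le_exp (by positivity)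
    have h2 : 1 ≤ Real.exp L := Real.one_le_exp hL0
    have h3 : 1 ≤ Real.exp (2 * L ^ 2) * Real.exp L := one_le_mul_of_one_le_of_one_le h1 h2
    have h4 : Real.exp (2 * L ^ 2) ≤ Real.exp (2 * L ^ 2) * Real.exp L :=
      le_mul_of_one_le_right (by positivity) h2
    rw [hG]
    gcongr
    calc 2 * A * D ^ k * H + 1 + D ^ k + (Nat.factorial k : ℝ)
        ≤ 2 * A * Real.exp (2 * L ^ 2) * Real.exp L + Real.exp (2 * L ^ 2) * Real.exp L +
          Real.exp (2 * L ^ 2) * Real.exp L + Real.exp (2 * L ^ 2) * Real.exp L := by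
          gcongr
          · exact hDk.trans h4
          · exact hfac.trans h4
      _ = (2 * A + 3) * (Real.exp (2 * L ^ 2) * Real.exp L) := by ring
      _ ≤ _ := by gcongr
  calc G * w ≤ Real.exp L * (Real.exp L * (Real.exp (2 * L ^ 2) * Real.exp L)) * Real.exp L := by
        gcongr
    _ = Real.exp (2 * L ^ 2 + 4 * L) := by
      simp only [← Real.exp_add]
      ring_nf
    _ ≤ _ := Real.exp_le_exp.2 (by nlinarith)

end Assembly

/-- **Proposition 3.4, even case**: with `x = N^{1/log log N}`, uniformly for even
`k ≪_{n,r} log log N`,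
`𝔼_N((π_{f,r}(x) − δ(r)π(x))^k) = C_{k,r}·π(x)^{k/2}·(1 + O_{n,r}((1/(1−δ(r))^{k/2})·(log log x)/π(x)^{1/2}))`. -/
theorem central_moments_even (n : ℕ) (hn : 2 ≤ n) (r : Fin n → ℕ)
    (hr : ∑ i : Fin n, ((i : ℕ) + 1) * r i = n) :
    ∃ c > (0 : ℝ), ∃ C > (0 : ℝ), ∃ N₀ : ℕ, ∀ N : ℕ, N₀ ≤ N → ∀ k : ℕ, Even k →
      (k : ℝ) ≤ c * Real.log (Real.log (N : ℝ)) →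
      |expN n N (fun f =>
          ((countSplit n r f ((N : ℝ) ^ (1 / Real.log (Real.log (N : ℝ)))) : ℝ) -
            splitDelta n r *
              (primePi ((N : ℝ) ^ (1 / Real.log (Real.log (N : ℝ)))) : ℝ)) ^ k) -
        CkrEven n r k *
          (primePi ((N : ℝ) ^ (1 / Real.log (Real.log (N : ℝ)))) : ℝ) ^ (k / 2)| ≤
      C * CkrEven n r k *
          (primePi ((N : ℝ) ^ (1 / Real.log (Real.log (N : ℝ)))) : ℝ) ^ (k / 2) *
          (1 / (1 - splitDelta n r) ^ (k / 2)) *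
          (Real.log (Real.log ((N : ℝ) ^ (1 / Real.log (Real.log (N : ℝ))))) /
            (primePi ((N : ℝ) ^ (1 / Real.log (Real.log (N : ℝ)))) : ℝ) ^ ((1 : ℝ) / 2)) := by
  obtain ⟨A, hA, hmom⟩ := exists_residueMean_moment_le hn hr
  have hδ := splitDelta_pos r
  have hδ1 := splitDelta_lt_one hn hr
  set δ := splitDelta n r with hδdef
  set v := δ - δ ^ 2 with hvdef
  have hv : 0 < v := by nlinarith
  have hlogN : Tendsto (fun N : ℕ => Real.log N) atTop atTop :=
    Real.tendsto_log_atTop.comp tendsto_natCast_atTop_atTop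
  have hL : Tendsto (fun N : ℕ => Real.log (Real.log N)) atTop atTop :=
    Real.tendsto_log_atTop.comp hlogN
  have hdiv : Tendsto (fun L : ℝ => Real.exp L / L ^ 1) atTop atTop :=
    Real.tendsto_exp_div_pow_atTop 1
  have hx : Tendsto (fun L : ℝ => Real.exp (Real.exp L / L ^ 1)) atTop atTop :=
    Real.tendsto_exp_atTop.comp hdiv
  obtain ⟨N₀, hN₀⟩ := eventually_atTop.1 <|
    (hlogN.eventually_gt_atTop 0).and <| (hL.eventually_ge_atTop 4).and <|
    (hL.eventually ((Real.tendsto_exp_div_pow_atTop 4).eventually_ge_atTop 16)).and <|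
    (hL.eventually (hdiv.eventually_ge_atTop (A + 1))).and <|
    (hL.eventually (Real.tendsto_exp_atTop.eventually_ge_atTop (2 * A + 3))).and <|
    (hL.eventually (Real.tendsto_exp_atTop.eventually_ge_atTop v⁻¹)).and <|
    (hL.eventually (Real.tendsto_exp_atTop.eventually_ge_atTop (2 ^ n))).and <|
    (hL.eventually (hx.eventually eventually_rpow_le_card_primesTo)).and <|
    (eventually_card_sdiff_P0_le hn).and (eventually_gt_atTop 0)
  refine ⟨1 / 100, by norm_num, 3, by norm_num, N₀, fun N hN k hk hkL => ?_⟩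
  obtain ⟨hlog0, hL4, hL16, hAL, hA3, hwL, h2n, hT, hP0, hN0⟩ := hN₀ N hN
  obtain ⟨m, rfl⟩ : ∃ m, k = 2 * m := ⟨k / 2, by obtain ⟨j, rfl⟩ := hk; omega⟩
  rw [Nat.mul_div_cancel_left m two_pos, CkrEven_two_mul]
  set L := Real.log (Real.log (N : ℝ)) with hLdef
  have hLpos : 0 < L := by linarith
  have hNR : (0 : ℝ) < N := by exact_mod_cast hN0
  have hlogNL : Real.log N = Real.exp L := (Real.exp_log hlog0).symm
  have hNexp : (N : ℝ) = Real.exp (Real.exp L) := by rw [← hlogNL, Real.exp_log hNR]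
  have hxexp : (N : ℝ) ^ (1 / L) = Real.exp (Real.exp L / L) := by
    rw [Real.rpow_def_of_pos hNR, hlogNL, mul_one_div]
  rw [pow_one] at hAL hT
  rw [le_div_iff₀ (by positivity)] at hL16 hAL
  rw [hxexp, Real.log_exp]
  set u := Real.exp L / L with hu
  have hLu : L * u = Real.exp L := by rw [hu]; field_simp
  have hu16 : 16 * L ^ 3 ≤ u := by
    rw [hu, le_div_iff₀ hLpos]
    linarith [pow_succ L 3]
  have hL3 : 64 ≤ L ^ 3 := by
    calc (64 : ℝ) = 4 ^ 3 := by norm_num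
      _ ≤ L ^ 3 := by gcongr
  have hL44 : 16 * L ^ 2 ≤ L ^ 4 := by
    calc 16 * L ^ 2 = 4 ^ 2 * L ^ 2 := by norm_num
      _ ≤ L ^ 2 * L ^ 2 := by gcongr
      _ = L ^ 4 := by ring
  have hL2 : 4 * L ≤ L ^ 2 := by rw [pow_two]; gcongr
  have hu0 : 0 < u := by linarith
  have hlogu : 1 ≤ Real.log u := by
    rw [Real.le_log_iff_exp_le hu0]
    linarith [Real.exp_one_lt_d9]
  have hyx : (⌊Real.exp u⌋₊ : ℝ) ≤ Real.exp u := Nat.floor_le (by positivity)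
  have hpi : primePi (Real.exp u) = #(primesTo ⌊Real.exp u⌋₊) := rfl
  simp only [hδdef, countSplit_sub_eq_sum]
  rw [hpi, ← hδdef, ← hvdef]
  have hy1 : 1 ≤ ⌊Real.exp u⌋₊ := Nat.le_floor (by simpa using Real.one_le_exp hu0.le)
  set y := ⌊Real.exp u⌋₊ with hy
  have hTy : (#(primesTo y) : ℝ) ≤ Real.exp u :=
    le_trans (by exact_mod_cast card_primesTo_le y) hyx
  have hexpand := hmom y (2 * m) _ _ rfl rfl
  have hH := sum_one_div_primesTo_le y
  have hH0 : 0 ≤ ∑ p ∈ primesTo y, 1 / (p : ℝ) := sum_nonneg fun _ _ => by positivity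
  set T := (#(primesTo y) : ℝ) with hTdef
  clear_value T y u v δ L
  clear hN₀ hlogN hL hdiv hx hpi hLdef hvdef hδdef hy
  have hT1 : 1 ≤ T := le_trans (Real.one_le_rpow (Real.one_le_exp hu0.le) (by norm_num)) hT
  have hT0 : 0 < T := by linarith
  have hexpL : 16 * 256 ≤ Real.exp L := by linarith
  -- powers of `N` and of `x`
  have hN8 : (N : ℝ) ^ (-(1 / 8) : ℝ) = Real.exp (-(Real.exp L / 8)) := by
    rw [Real.rpow_def_of_pos hNR, hlogNL]; ring_nf
  have hxk : Real.exp u ^ (2 * m) ≤ Real.exp (Real.exp L / 100) := by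
    rw [← Real.exp_nat_mul, ← hLu]
    refine Real.exp_le_exp.2 ?_
    calc ((2 * m : ℕ) : ℝ) * u ≤ 1 / 100 * L * u := by gcongr
      _ = _ := by ring
  have hmL : (m : ℝ) ≤ L := by
    push_cast at hkL
    linarith
  have hwm : v⁻¹ ^ m ≤ Real.exp (L ^ 2) := by
    calc v⁻¹ ^ m ≤ Real.exp L ^ m := by gcongr
      _ = Real.exp (m * L) := by rw [← Real.exp_nat_mul]
      _ ≤ _ := Real.exp_le_exp.2 (by rw [pow_two]; gcongr)
  have hLL : L ^ 2 + L + 6 ≤ Real.exp L / 100 * 9 := by linarith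
  have hvm : 0 < v ^ m := by positivity
  have hβ : 3 * (N : ℝ) ^ (-(1 / 8) : ℝ) < 1 := by
    have h1 : (3 : ℝ) < Real.exp (Real.exp L / 8) := by
      linarith [Real.add_one_le_exp (Real.exp L / 8)]
    rw [hN8, Real.exp_neg, ← div_eq_mul_inv, div_lt_one (by positivity)]
    exact h1
  have hgauss : v ^ m ≤ gaussMoment v m := le_gaussMoment hv.le m
  rcases Nat.eq_zero_or_pos m with rfl | hm
  · have hPc : (#(P0 n N) : ℝ) ≠ 0 := by 
      exact_mod_cast (P0_nonempty_of_card_sdiff_le hβ hP0).card_ne_zero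
    simp [gaussMoment_zero, expN, hPc]
    positivity
  have hTm : T ^ (1 / 2 : ℝ) ≤ T ^ m := by
    rw [← Real.rpow_natCast]
    refine Real.rpow_le_rpow_of_exponent_le hT1 ?_
    have : (1 : ℝ) ≤ m := by exact_mod_cast hm
    linarith
  have hThalf : 0 < T ^ (1 / 2 : ℝ) := by positivity
  have hbase : v ^ m ≤ v ^ m * (T ^ m / T ^ (1 / 2 : ℝ)) :=
    le_mul_of_one_le_right hvm.le ((one_le_div hThalf).2 hTm)
  have hcomp : |expN n N (fun a => (∑ p ∈ primesTo y, splitDev r p a) ^ (2 * m)) -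
      residueMean (∏ p ∈ primesTo y, p)
        (fun a => (∑ p ∈ primesTo y, splitDev r p a) ^ (2 * m))| ≤ 2 * v ^ m := by
    have h1 : T ^ (2 * m) ≤ Real.exp (Real.exp L / 100) :=
      (pow_le_pow_left₀ hT0.le hTy _).trans hxk
    have h2 : (y : ℝ) ^ (2 * m) ≤ Real.exp (Real.exp L / 100) :=
      (pow_le_pow_left₀ (Nat.cast_nonneg y) hyx _).trans hxk
    have h3 : Real.exp (Real.exp L / 100) ≤ N := by
      rw [hNexp]; exact Real.exp_le_exp.2 (by linarith)
    have h4 : (y : ℝ) ^ (2 * m) ≤ 2 * N + 1 := by linarith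
    have h5 : Real.exp (-(L ^ 2)) ≤ v ^ m := by
      rw [Real.exp_neg]
      rw [inv_pow] at hwm
      exact inv_le_of_inv_le₀ hvm hwm
    have h6 : (6 : ℝ) ≤ Real.exp 6 := by linarith [Real.add_one_le_exp (6 : ℝ)]
    refine (abs_expN_moment_sub_residueMean_le hn hr hy1 (by exact_mod_cast h4) hβ hP0).trans ?_
    have h7 : T ^ (2 * m) * (2 * (3 * (N : ℝ) ^ (-(1 / 8) : ℝ))) ≤ v ^ m := by
      calc T ^ (2 * m) * (2 * (3 * (N : ℝ) ^ (-(1 / 8) : ℝ)))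
          = 6 * (T ^ (2 * m) * Real.exp (-(Real.exp L / 8))) := by rw [hN8]; ring
        _ ≤ Real.exp 6 * (Real.exp (Real.exp L / 100) * Real.exp (-(Real.exp L / 8))) := by
          gcongr
        _ ≤ Real.exp (-(L ^ 2)) := by
          rw [← Real.exp_add, ← Real.exp_add]
          exact Real.exp_le_exp.2 (by linarith)
        _ ≤ v ^ m := h5
    have h8 : T ^ (2 * m) * (2 ^ n * ((y : ℝ) ^ (2 * m) / (2 * N + 1))) ≤ v ^ m := by
      calc T ^ (2 * m) * (2 ^ n * ((y : ℝ) ^ (2 * m) / (2 * N + 1)))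
          ≤ Real.exp (Real.exp L / 100) *
            (Real.exp L * (Real.exp (Real.exp L / 100) / N)) := by
            gcongr
            linarith
        _ = Real.exp (Real.exp L / 100 + L + Real.exp L / 100 - Real.exp L) := by
          rw [hNexp, Real.exp_sub, Real.exp_add, Real.exp_add]
          ring
        _ ≤ Real.exp (-(L ^ 2)) := Real.exp_le_exp.2 (by linarith)
        _ ≤ v ^ m := h5
    rw [mul_add, ← hTdef]
    linarith
  have hmain : |residueMean (∏ p ∈ primesTo y, p)
      (fun a => (∑ p ∈ primesTo y, splitDev r p a) ^ (2 * m)) - gaussMoment v m * T ^ m| ≤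
      v ^ m * (T ^ m / T ^ (1 / 2 : ℝ)) := by
    have h1 := hexpand.2 m rfl
    have hHL : ∑ p ∈ primesTo y, 1 / (p : ℝ) ≤ Real.exp L := by
      have h2 : Real.log y ≤ u := by
        rw [Real.log_le_iff_le_exp (by exact_mod_cast hy1)]
        exact hyx
      have h3 : 4 * u ≤ L * u := by gcongr
      linarith
    have h3 := recConst_le_exp hA hH0 (by positivity : 0 ≤ v⁻¹) (by linarith : 1 ≤ L)
      (by linarith : ((2 * m : ℕ) : ℝ) ≤ L) hHL hwL (by linarith) hA3 rfl rfl
    set D := ((2 * m : ℕ) : ℝ) * A * ∑ p ∈ primesTo y, 1 / (p : ℝ) + 2 ^ (2 * m)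
    set G := 2 ^ (2 * m) * (2 * A * D ^ (2 * m) * ∑ p ∈ primesTo y, 1 / (p : ℝ) + 1 +
      D ^ (2 * m) + Nat.factorial (2 * m))
    have hG0 : 0 ≤ G := by positivity
    have h4 : (G * v⁻¹) ^ m ≤ T ^ (1 / 2 : ℝ) := by
      calc (G * v⁻¹) ^ m ≤ Real.exp (6 * L ^ 2) ^ m := by gcongr
        _ = Real.exp (m * (6 * L ^ 2)) := by rw [← Real.exp_nat_mul]
        _ ≤ Real.exp (3 / 8 * u) := Real.exp_le_exp.2 (by
          calc (m : ℝ) * (6 * L ^ 2) ≤ L * (6 * L ^ 2) := by gcongr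
            _ ≤ _ := by linarith [pow_succ L 2])
        _ = (Real.exp u ^ (3 / 4 : ℝ)) ^ (1 / 2 : ℝ) := by
          rw [← Real.rpow_mul (by positivity), ← Real.exp_mul]
          ring_nf
        _ ≤ _ := by gcongr
    have h5 : G ^ m ≤ v ^ m * T ^ (1 / 2 : ℝ) := by
      rw [mul_pow, inv_pow, mul_inv_le_iff₀ hvm] at h4
      linarith
    have h6 : T ^ (1 / 2 : ℝ) * T ^ (1 / 2 : ℝ) = T := by
      rw [← Real.rpow_add hT0]; norm_num
    refine le_of_mul_le_mul_left (h1.trans ?_) hT0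
    calc G ^ m * T ^ m ≤ v ^ m * T ^ (1 / 2 : ℝ) * T ^ m := by gcongr
      _ = T ^ (1 / 2 : ℝ) * T ^ (1 / 2 : ℝ) * (v ^ m * (T ^ m / T ^ (1 / 2 : ℝ))) := by
        field_simp
      _ = _ := by rw [h6]
  have hRHS : 3 * (v ^ m * (T ^ m / T ^ (1 / 2 : ℝ))) ≤
      3 * gaussMoment v m * T ^ m * (1 / (1 - δ) ^ m) * (Real.log u / T ^ (1 / 2 : ℝ)) := by
    have h1 : 1 ≤ 1 / (1 - δ) ^ m := by
      have h0 : 0 < 1 - δ := by linarith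
      rw [one_le_div (by positivity)]
      exact pow_le_one₀ h0.le (by linarith)
    calc 3 * (v ^ m * (T ^ m / T ^ (1 / 2 : ℝ)))
        = 3 * v ^ m * T ^ m * 1 * (1 / T ^ (1 / 2 : ℝ)) := by ring
      _ ≤ _ := by
        have h0 : 0 ≤ gaussMoment v m := gaussMoment_nonneg hv.le m
        gcongr
  refine le_trans ?_ hRHS
  refine (abs_sub_le _ (residueMean (∏ p ∈ primesTo y, p)
    fun a => (∑ p ∈ primesTo y, splitDev r p a) ^ (2 * m)) _).trans ?_
  linarith

end
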